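/- Let V be an irreducible integrable module for the twisted full toroidal Lie algebra τ̃ of level zero having finite-dimensional weight spaces with respect to h̃, and V₊ = {v ∈ V : τ̃₊·v = 0}. Then: (1) V₊ is an irreducible module over τ̃₀; (2) the weights of V₊ are the same up to a translate of a subset of the null roots, i.e. there exists a unique λ̄ ∈ 𝔥_{0̄}* and some β ∈ ℂⁿ (not necessarily unique) such that P(V₊) ⊆ {λ̄ + δ_{r+β} : r ∈ ℤⁿ}, where δ_{r+β} = Σᵢ (rᵢ+βᵢ)δᵢ. -/

import Mathlib

open scoped BigOperators TensorProduct

noncomputable section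

/-- Stage 1: a finite-dimensional simple complex Lie algebra `g` together with `n` commuting
automorphisms `σ i` of finite orders `m i`, fixed primitive roots of unity `ξ i`, and the
invariant nondegenerate symmetric bilinear form `bil`. -/
structure PreT where
  n : ℕ
  npos : 0 < n
  m : Fin n → ℕ
  mpos : ∀ i, 0 < m i
  g : Type
  [gLR : LieRing g]
  [gLA : LieAlgebra ℂ g]
  gfin : FiniteDimensional ℂ g
  gsimple : LieAlgebra.IsSimple ℂ g
  σ : Fin n → (g ≃ₗ⁅ℂ⁆ g)
  σcomm : ∀ i j x, σ i (σ j x) = σ j (σ i x)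
  σord : ∀ i x, (fun y => σ i y)^[m i] x = x
  ξ : Fin n → ℂ
  ξprim : ∀ i, IsPrimitiveRoot (ξ i) (m i)
  bil : g →ₗ[ℂ] g →ₗ[ℂ] ℂ
  bil_symm : ∀ x y, bil x y = bil y x
  bil_invariant : ∀ x y z, bil ⁅x, y⁆ z = bil x ⁅y, z⁆
  bil_nondeg : ∀ x, (∀ y, bil x y = 0) → x = 0
  bil_aut : ∀ i x y, bil (σ i x) (σ i y) = bil x y

attribute [instance] PreT.gLR PreT.gLA

namespace PreT

variable (P : PreT)

/-- membership in the lattice `Γ = m₁ℤ ⊕ … ⊕ mₙℤ`. -/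
def inΓ (r : Fin P.n → ℤ) : Prop := ∀ i, (P.m i : ℤ) ∣ r i

/-- the common eigenspace `𝔤_{k̄} = {x | σᵢ x = ξᵢ^{kᵢ} x}`. -/
def gr (k : Fin P.n → ℤ) : Submodule ℂ P.g :=
  ⨅ i, LinearMap.ker
    ((P.σ i).toLinearEquiv.toLinearMap - P.ξ i ^ (k i) • (1 : Module.End ℂ P.g))

/-- Ĝ-characters: group homomorphisms `ℤⁿ/Γ → ℂˣ` presented as `Γ`-periodic functions. -/
def IsChar (χ : (Fin P.n → ℤ) → ℂ) : Prop :=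
  (∀ k l, χ (k + l) = χ k * χ l) ∧ (∀ r, P.inΓ r → χ r = 1)

end PreT

/-- Stage 2: a Cartan subalgebra `h0 = 𝔥_{0̄}` of `𝔤_{0̄}` (abelian and self-normalizing
in `𝔤_{0̄}`). -/
structure Cartan (P : PreT) where
  h0 : Submodule ℂ P.g
  h0_le : h0 ≤ P.gr 0
  h0_ne : h0 ≠ ⊥
  h0_abelian : ∀ x ∈ h0, ∀ y ∈ h0, ⁅x, y⁆ = 0
  h0_selfnorm : ∀ x ∈ P.gr 0, (∀ h ∈ h0, ⁅h, x⁆ ∈ h0) → x ∈ h0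

namespace Cartan

variable {P : PreT} (C : Cartan P)

/-- the full weight space `{x ∈ 𝔤 | [h,x] = α(h)x ∀ h ∈ 𝔥_{0̄}}` of `𝔤` for `α ∈ 𝔥_{0̄}*`. -/
def wtfull (α : Module.Dual ℂ ↥C.h0) : Submodule ℂ P.g :=
  ⨅ h : ↥C.h0, LinearMap.ker
    (LieAlgebra.ad ℂ P.g (h : P.g) - α h • (1 : Module.End ℂ P.g))

/-- the root space `𝔤_{k̄}(α)`. -/
def wtg (k : Fin P.n → ℤ) (α : Module.Dual ℂ ↥C.h0) : Submodule ℂ P.g :=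
  P.gr k ⊓ C.wtfull α

/-- the set `Δ^× = Δ_{0,en}^×` of nonzero roots. -/
def Δen : Set (Module.Dual ℂ ↥C.h0) :=
  {α | α ≠ 0 ∧ ∃ k, C.wtg k α ≠ ⊥}

/-- weights for `h̃ = 𝔥_{0̄} ⊕ ⊕ᵢℂKᵢ ⊕ ⊕ᵢℂdᵢ`: a functional on `𝔥_{0̄}` together with the
values on `K₁,…,Kₙ` and on `d₁,…,dₙ`. -/
abbrev Wt : Type := Module.Dual ℂ ↥C.h0 × (Fin P.n → ℂ) × (Fin P.n → ℂ)

/-- a real root `γ = α + δ_k` of `τ̃`, regarded as an element of `h̃*`. -/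
def rootFn (α : Module.Dual ℂ ↥C.h0) (k : Fin P.n → ℤ) : C.Wt :=
  (α, 0, fun i => (k i : ℂ))

end Cartan

/-- Stage 3: the Lie-torus axioms together with a choice of a positive system and of coroots for
the (extended) root system `Δ_{0,en}`. -/
structure Torus (P : PreT) (C : Cartan P) where
  /-- `𝔤_{0̄}` is a (finite-dimensional) simple Lie algebra: no proper nonzero ideals … -/
  g0_ideals : ∀ U : Submodule ℂ P.g, U ≤ P.gr 0 →
    (∀ x ∈ P.gr 0, ∀ u ∈ U, ⁅x, u⁆ ∈ U) → U = ⊥ ∨ U = P.gr 0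
  /-- … and nonabelian. -/
  g0_nonabelian : ∃ x ∈ P.gr 0, ∃ y ∈ P.gr 0, ⁅x, y⁆ ≠ 0
  /-- condition (M): for `k̄ ≠ 0̄` with `𝔤_{k̄} ≠ 0`, `𝔤_{k̄} ≅ U ⊕ W` with `U` a trivial
  `𝔤_{0̄}`-module and `W` zero or irreducible of dimension `> 1` with weights in `Δ_{0,en}`. -/
  cond_M : ∀ k : Fin P.n → ℤ, ¬ P.inΓ k → P.gr k ≠ ⊥ →
    ∃ U W : Submodule ℂ P.g, U ≤ P.gr k ∧ W ≤ P.gr k ∧ U ⊓ W = ⊥ ∧ U ⊔ W = P.gr k ∧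
      (∀ x ∈ P.gr 0, ∀ u ∈ U, ⁅x, u⁆ = 0) ∧
      (W = ⊥ ∨
        ((∀ U' : Submodule ℂ P.g, U' ≤ W →
            (∀ x ∈ P.gr 0, ∀ u ∈ U', ⁅x, u⁆ ∈ U') → U' = ⊥ ∨ U' = W) ∧
          1 < Module.finrank ℂ ↥W ∧
          W ≤ ⨆ α ∈ insert (0 : Module.Dual ℂ ↥C.h0) C.Δen, C.wtfull α))
  /-- condition (iii): the group generated by `σ₁,…,σₙ` has order `m₁ ⋯ mₙ`. -/
  ord_faithful : ∀ k : Fin P.n → ℤ,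
    (∀ l, P.gr l ≠ ⊥ → (∏ i, P.ξ i ^ (k i * l i)) = 1) → P.inΓ k
  /-- a positive system for `Δ_{0,en}`. -/
  pos : Set (Module.Dual ℂ ↥C.h0)
  pos_sub : pos ⊆ C.Δen
  pos_total : ∀ α ∈ C.Δen, α ∈ pos ∨ -α ∈ pos
  pos_disj : ∀ α ∈ pos, -α ∉ pos
  pos_add : ∀ α ∈ pos, ∀ β ∈ pos, α + β ∈ C.Δen → α + β ∈ pos
  /-- coroots `α∨ ∈ 𝔥_{0̄}`. -/
  coroot : Module.Dual ℂ ↥C.h0 → ↥C.h0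
  coroot_two : ∀ α ∈ C.Δen, α (coroot α) = 2
  coroot_neg : ∀ α ∈ C.Δen, coroot (-α) = - coroot α
  /-- `cnorm α = 2/(α|α)`, characterized via the bilinear form. -/
  cnorm : Module.Dual ℂ ↥C.h0 → ℂ
  cnorm_spec : ∀ α ∈ C.Δen, ∀ h : ↥C.h0,
    P.bil ((coroot α : P.g)) ((h : P.g)) = cnorm α * α h

namespace Torus

variable {P : PreT} {C : Cartan P} (T : Torus P C)

/-- evaluation `λ(γ∨)` of a weight `λ` at the coroot `γ∨ = α∨ + (2/(α|α)) Σᵢ kᵢKᵢ` of the real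
root `γ = α + δ_k`. -/
def corootEval (α : Module.Dual ℂ ↥C.h0) (k : Fin P.n → ℤ) (w : C.Wt) : ℂ :=
  w.1 (T.coroot α) + T.cnorm α * ∑ i, (k i : ℂ) * w.2.1 i

/-- the reflection `r_γ(λ) = λ - λ(γ∨)γ` on `h̃*`. -/
def reflFn (α : Module.Dual ℂ ↥C.h0) (k : Fin P.n → ℤ) : Function.End C.Wt :=
  fun w => w - T.corootEval α k w • C.rootFn α k

/-- the Weyl group `W` of `τ̃`, generated by the reflections in the real roots
(realized inside the monoid of self-maps of `h̃*`; as the generators are involutions this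
coincides with the generated group). -/
def weyl : Submonoid (Function.End C.Wt) :=
  Submonoid.closure {f | ∃ α ∈ C.Δen, ∃ k, f = T.reflFn α k}

end Torus

/-- Stage 4: the twisted full toroidal Lie algebra
`τ̃ = LT ⊕ 𝒵(m) ⊕ 𝒟(m)`.  The elements `E k x` (for `x ∈ 𝔤_{k̄}`), `K r i` and `Dop r i`
(for `r ∈ Γ`) realize `x ⊗ t^k`, `t^r Kᵢ` and `t^r dᵢ`, subject to the standard toroidal
bracket relations, with 2-cocycle `φ = c1 • φ₁ + c2 • φ₂`. -/
structure Toroidal (P : PreT) (C : Cartan P) (T : Torus P C) where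
  τ : Type
  [τLR : LieRing τ]
  [τLA : LieAlgebra ℂ τ]
  E : (Fin P.n → ℤ) → P.g →ₗ[ℂ] τ
  K : (Fin P.n → ℤ) → Fin P.n → τ
  Dop : (Fin P.n → ℤ) → Fin P.n → τ
  c1 : ℂ
  c2 : ℂ
  K_not : ∀ r i, ¬ P.inΓ r → K r i = 0
  Dop_not : ∀ r i, ¬ P.inΓ r → Dop r i = 0
  /-- the relation `Σᵢ rᵢ t^r Kᵢ = 0` coming from `dA(m)` in `𝒵(m) = Ω_{A(m)}/dA(m)`. -/
  K_dA : ∀ r, P.inΓ r → ∑ i, (r i : ℂ) • K r i = 0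
  br_EE : ∀ k l x y, x ∈ P.gr k → y ∈ P.gr l →
    ⁅E k x, E l y⁆ = E (k + l) ⁅x, y⁆ + P.bil x y • ∑ i, (k i : ℂ) • K (k + l) i
  br_EK : ∀ k x, x ∈ P.gr k → ∀ r i, ⁅E k x, K r i⁆ = 0
  br_KK : ∀ r s i j, ⁅K r i, K s j⁆ = 0
  br_DK : ∀ r s, P.inΓ r → P.inΓ s → ∀ i j,
    ⁅Dop r i, K s j⁆ = (s i : ℂ) • K (r + s) j +
      (if i = j then (1 : ℂ) else 0) • ∑ p, (r p : ℂ) • K (r + s) p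
  br_DD : ∀ r s, P.inΓ r → P.inΓ s → ∀ i j,
    ⁅Dop r i, Dop s j⁆ = (s i : ℂ) • Dop (r + s) j - (r j : ℂ) • Dop (r + s) i +
      (c1 * (-(s i : ℂ) * (r j : ℂ)) + c2 * ((r i : ℂ) * (s j : ℂ))) •
        ∑ p, (r p : ℂ) • K (r + s) p
  br_DE : ∀ r, P.inΓ r → ∀ i k x, x ∈ P.gr k → ⁅Dop r i, E k x⁆ = (k i : ℂ) • E (r + k) x
  span_top : Submodule.span ℂ
    ({t | ∃ k x, x ∈ P.gr k ∧ t = E k x} ∪ {t | ∃ r i, P.inΓ r ∧ t = K r i} ∪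
      {t | ∃ r i, P.inΓ r ∧ t = Dop r i}) = ⊤
  E_inj : ∀ k x, x ∈ P.gr k → E k x = 0 → x = 0

attribute [instance] Toroidal.τLR Toroidal.τLA

namespace Toroidal

variable {P : PreT} {C : Cartan P} {T : Torus P C} (X : Toroidal P C T)

/-- the generators `𝔤_{k̄}(α) ⊗ ℂt^k`, `α` positive, of `τ̃₊`. -/
def tauP : Set X.τ :=
  {t | ∃ α ∈ T.pos, ∃ k x, x ∈ C.wtg k α ∧ t = X.E k x}

/-- the generators `𝔤_{k̄}(α) ⊗ ℂt^k`, `α` negative, of `τ̃₋`. -/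
def tauM : Set X.τ :=
  {t | ∃ α, -α ∈ T.pos ∧ ∃ k x, x ∈ C.wtg k α ∧ t = X.E k x}

/-- the generators `𝔤_{k̄}(0) ⊗ ℂt^k`, `t^rKᵢ`, `t^rdᵢ` of `τ̃₀`. -/
def tauZ : Set X.τ :=
  {t | (∃ k x, x ∈ C.wtg k 0 ∧ t = X.E k x) ∨
    (∃ r i, P.inΓ r ∧ (t = X.K r i ∨ t = X.Dop r i))}

/-- the generators of `τ̂ = LT ⊕ 𝒟(m)`. -/
def tauHat : Set X.τ :=
  {t | (∃ k x, x ∈ P.gr k ∧ t = X.E k x) ∨ (∃ r i, P.inΓ r ∧ t = X.Dop r i)}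

/-- the element `I(u,r) = D(u,r) - D(u,0) = Σᵢ uᵢ t^r dᵢ - Σᵢ uᵢ dᵢ`. -/
def Iop (u : Fin P.n → ℂ) (r : Fin P.n → ℤ) : X.τ :=
  ∑ i, u i • X.Dop r i - ∑ i, u i • X.Dop 0 i

/-- generators of `L̃ = I ⋉ L(g̊,σ)`, where `g̊` is the centralizer of `𝔥_{0̄}` in `𝔤`. -/
def Ltil : Set X.τ :=
  {t | (∃ u r, P.inΓ r ∧ t = X.Iop u r) ∨
    (∃ k x, x ∈ P.gr k ∧ x ∈ C.wtfull 0 ∧ t = X.E k x)}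

/-- generators of `I ⋉ (𝔥_{0̄} ⊗ A(m))`. -/
def IhGen : Set X.τ :=
  {t | (∃ u r, P.inΓ r ∧ t = X.Iop u r) ∨
    (∃ r h, P.inΓ r ∧ h ∈ C.h0 ∧ h ∈ P.gr r ∧ h ∈ C.wtfull 0 ∧ t = X.E r h)}

end Toroidal

/-- a representation of `τ̃` on a complex vector space. -/
structure TRep {P : PreT} {C : Cartan P} {T : Torus P C} (X : Toroidal P C T) where
  V : Type
  [Vadd : AddCommGroup V]
  [Vmod : Module ℂ V]
  ρ : X.τ →ₗ[ℂ] Module.End ℂ V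
  ρ_lie : ∀ a b : X.τ, ρ ⁅a, b⁆ = ρ a * ρ b - ρ b * ρ a

attribute [instance] TRep.Vadd TRep.Vmod

namespace TRep

variable {P : PreT} {C : Cartan P} {T : Torus P C} {X : Toroidal P C T} (M : TRep X)

/-- the weight space `V_w` with respect to `h̃`. -/
def wtSp (w : C.Wt) : Submodule ℂ M.V :=
  (⨅ h : ↥C.h0, LinearMap.ker (M.ρ (X.E 0 (h : P.g)) - w.1 h • (1 : Module.End ℂ M.V))) ⊓
  (⨅ i, LinearMap.ker (M.ρ (X.K 0 i) - w.2.1 i • (1 : Module.End ℂ M.V))) ⊓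
  (⨅ i, LinearMap.ker (M.ρ (X.Dop 0 i) - w.2.2 i • (1 : Module.End ℂ M.V)))

/-- the set `P(V)` of weights of `V`. -/
def wts : Set C.Wt := {w | M.wtSp w ≠ ⊥}

/-- `V` is a weight module: `V = ⊕_{λ ∈ h̃*} V_λ`. -/
def IsWeight : Prop := (⨆ w : C.Wt, M.wtSp w) = ⊤

/-- `V` has finite-dimensional weight spaces. -/
def FinWt : Prop := ∀ w : C.Wt, FiniteDimensional ℂ ↥(M.wtSp w)

/-- integrability: `V` is a weight module on which all the root vectors
`x ∈ 𝔤_{k̄}(α) ⊗ ℂt^k`, `α ≠ 0`, act locally nilpotently. -/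
def Integrable : Prop :=
  M.IsWeight ∧ ∀ (k : Fin P.n → ℤ) (α : Module.Dual ℂ ↥C.h0), α ≠ 0 →
    ∀ x ∈ C.wtg k α, ∀ v : M.V, ∃ N : ℕ, (M.ρ (X.E k x) ^ N) v = 0

/-- level zero: the central elements `K₁, …, Kₙ` act trivially. -/
def LevelZero : Prop := ∀ i, M.ρ (X.K 0 i) = 0

/-- irreducibility of `V` over `τ̃`. -/
def Irr : Prop :=
  Nontrivial M.V ∧
    ∀ U : Submodule ℂ M.V, (∀ t : X.τ, ∀ v ∈ U, M.ρ t v ∈ U) → U = ⊥ ∨ U = ⊤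

/-- the Lie torus `LT` acts non-trivially on `V`. -/
def LTnontrivial : Prop := ∃ k x, x ∈ P.gr k ∧ M.ρ (X.E k x) ≠ 0

/-- the highest weight space `V₊ = {v ∈ V | τ̃₊ ⬝ v = 0}`. -/
def Vplus : Submodule ℂ M.V := ⨅ t ∈ X.tauP, LinearMap.ker (M.ρ t)

/-- `U(τ̃₀)v`: the smallest subspace of `V` containing `v` and invariant under `τ̃₀`. -/
def u0span (v : M.V) : Submodule ℂ M.V :=
  sInf {U | v ∈ U ∧ ∀ t ∈ X.tauZ, ∀ u ∈ U, M.ρ t u ∈ U}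

/-- `V` is a level zero highest weight module for `τ̃` (Definition 3.3). -/
def IsHW : Prop :=
  ∃ v : M.V, v ≠ 0 ∧ (∃ w : C.Wt, v ∈ M.wtSp w) ∧
    (∀ U : Submodule ℂ M.V, (∀ t : X.τ, ∀ u ∈ U, M.ρ t u ∈ U) → v ∈ U → U = ⊤) ∧
    (∀ t ∈ X.tauP, M.ρ t v = 0) ∧
    (∀ U : Submodule ℂ M.V, U ≤ M.u0span v →
      (∀ t ∈ X.tauZ, ∀ u ∈ U, M.ρ t u ∈ U) → U = ⊥ ∨ U = M.u0span v) ∧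
    (∀ i, M.ρ (X.K 0 i) = 0)

/-- simultaneous eigenspace for the degree derivations `d₁,…,dₙ`. -/
def dEig (b : Fin P.n → ℂ) : Submodule ℂ M.V :=
  ⨅ i, LinearMap.ker (M.ρ (X.Dop 0 i) - b i • (1 : Module.End ℂ M.V))

/-- the graded piece `V₊(k) = {v ∈ V₊ | dᵢ v = (Λ(dᵢ)+kᵢ) v}`. -/
def VplusGr (Λ : C.Wt) (k : Fin P.n → ℤ) : Submodule ℂ M.V :=
  M.Vplus ⊓ M.dEig (fun i => Λ.2.2 i + (k i : ℂ))

/-- `𝒵(m)` acts trivially on `V`. -/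
def Ztrivial : Prop := ∀ r, P.inΓ r → ∀ i, M.ρ (X.K r i) = 0

end TRep

/-- isomorphism of representations of `τ̃`. -/
def TRepIso {P : PreT} {C : Cartan P} {T : Torus P C} {X : Toroidal P C T}
    (M N : TRep X) : Prop :=
  ∃ e : M.V ≃ₗ[ℂ] N.V, ∀ t v, e (M.ρ t v) = N.ρ t (e v)

namespace Module.End

variable {ι K M : Type*} [Field K] [AddCommGroup M] [Module K M]

/-- The space of joint eigenvectors of a family of endomorphisms. -/
def jointEigenspace (f : ι → Module.End K M) (χ : ι → K) : Submodule K M :=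
  ⨅ i, (f i).eigenspace (χ i)

lemma mem_jointEigenspace {f : ι → Module.End K M} {χ : ι → K} {v : M} :
    v ∈ jointEigenspace f χ ↔ ∀ i, f i v = χ i • v := by
  simp [jointEigenspace]

lemma iSupIndep_jointEigenspace (f : ι → Module.End K M) (hf : ∀ i j, Commute (f i) (f j)) :
    iSupIndep (jointEigenspace f) := by
  refine (independent_iInf_maxGenEigenspace_of_forall_mapsTo f fun i j φ =>
    mapsTo_maxGenEigenspace_of_comm (hf j i) φ).mono fun χ => iInf_mono fun i => ?_
  exact (f i).genEigenspace_le_maximal (χ i) 1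

lemma eq_smul_of_sub_sq_apply_eq_zero {T : Module.End K M} {x : M} {c : K}
    (hx : x ∈ ⨆ a, T.eigenspace a)
    (h : (T - algebraMap K _ c) ((T - algebraMap K _ c) x) = 0) : T x = c • x := by
  have hx' : x ∈ T.eigenspace c ⊔ ⨆ a ≠ c, T.eigenspace a := by
    refine SetLike.le_def.1 (iSup_le fun a => ?_) hx
    by_cases hac : a = c
    · exact hac ▸ le_sup_left
    · exact le_sup_of_le_right (le_iSup₂_of_le a hac le_rfl)
  obtain ⟨y, hy, z, hz, rfl⟩ := Submodule.mem_sup.1 hx'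
  have hyc : (T - algebraMap K _ c) y = 0 := by
    simpa [mem_eigenspace_iff, sub_eq_zero] using hy
  have hz0 : z = 0 := by
    have hzc : z ∈ T.maxGenEigenspace c := by
      rw [mem_maxGenEigenspace]
      refine ⟨2, ?_⟩
      rw [map_add, hyc, zero_add] at h
      simpa [pow_two, Algebra.algebraMap_eq_smul_one] using h
    have := (T.independent_maxGenEigenspace c)
    refine Submodule.disjoint_def.1 this z hzc ?_
    refine SetLike.le_def.1 (iSup₂_mono fun a _ => ?_) hz
    exact T.genEigenspace_le_maximal a 1
  subst hz0
  simpa [mem_eigenspace_iff] using hy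

lemma pow_sub_apply_eq_zero {T : Module.End K M} {c : K} {p : Submodule K M}
    (hp : ∀ x ∈ p, T x ∈ p)
    (h : ∀ x ∈ p, (T - algebraMap K _ c) ((T - algebraMap K _ c) x) = 0 → T x = c • x)
    (n : ℕ) : ∀ x ∈ p, ((T - algebraMap K _ c) ^ n) x = 0 → T x = c • x := by
  induction n with
  | zero => intro x _ hx; simp at hx; simp [hx]
  | succ n ih =>
    intro x hx h0
    refine h x hx ?_
    have hm : (T - algebraMap K _ c) x ∈ p := by
      simpa using p.sub_mem (hp x hx) (p.smul_mem c hx)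
    have := ih _ hm (by simpa [pow_succ] using h0)
    rw [LinearMap.sub_apply, this, Module.algebraMap_end_apply, sub_self]

lemma le_iSup_inf_jointEigenspace [IsAlgClosed K] [FiniteDimensional K M]
    {f : ι → Module.End K M}
    (hf : ∀ i j, Commute (f i) (f j)) {p : Submodule K M} (hp : ∀ i, ∀ x ∈ p, f i x ∈ p)
    (h : ∀ i c, ∀ x ∈ p,
      (f i - algebraMap K _ c) ((f i - algebraMap K _ c) x) = 0 → f i x = c • x) :
    p ≤ ⨆ χ, p ⊓ jointEigenspace f χ := by
  have htop := iSup_iInf_maxGenEigenspace_eq_top_of_iSup_maxGenEigenspace_eq_top_of_commute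
    (fun i => (f i).restrict (hp i))
    (fun i j _ => LinearMap.ext fun x => Subtype.ext (LinearMap.congr_fun (hf i j) x))
    (fun i => iSup_maxGenEigenspace_eq_top _)
  have := congrArg (Submodule.map p.subtype) htop
  rw [Submodule.map_iSup, Submodule.map_top, Submodule.range_subtype] at this
  refine this.symm.trans_le (iSup_mono fun χ => ?_)
  rw [← Submodule.inf_iInf_maxGenEigenspace_of_forall_mapsTo f p hp]
  rintro x ⟨hx, hx'⟩
  refine ⟨hx, mem_jointEigenspace.2 fun i => ?_⟩
  simp only [Submodule.coe_iInf, Set.mem_iInter, SetLike.mem_coe] at hx'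
  obtain ⟨n, hn⟩ := (mem_maxGenEigenspace _ _ _).1 (hx' i)
  exact pow_sub_apply_eq_zero (hp i) (h i (χ i)) n x hx
    (by simpa [Algebra.algebraMap_eq_smul_one] using hn)

end Module.End

lemma iSupIndep.eq_zero_of_finsupp_sum_eq_zero {ι K M : Type*} [Field K] [AddCommGroup M]
    [Module K M] {N : ι → Submodule K M} (hN : iSupIndep N) {s : Finset ι} {v : ι → M}
    (hv : ∀ i ∈ s, v i ∈ N i) (h : ∑ i ∈ s, v i = 0) : ∀ i ∈ s, v i = 0 := by
  classical
  intro i hi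
  refine Submodule.disjoint_def.1 (hN i) _ (hv i hi) ?_
  rw [← Finset.add_sum_erase s v hi, add_eq_zero_iff_eq_neg] at h
  rw [h]
  refine Submodule.neg_mem _ (Submodule.sum_mem _ fun j hj => ?_)
  rw [Finset.mem_erase] at hj
  exact Submodule.mem_iSup_of_mem j (Submodule.mem_iSup_of_mem hj.1 (hv j hj.2))

/-- A primitive vector on which `f` is nilpotent has a natural number as its weight. -/
lemma IsSl2Triple.HasPrimitiveVectorWith.exists_nat_of_pow_eq_zero {K L M : Type*} [Field K]
    [CharZero K] [LieRing L] [LieAlgebra K L] [AddCommGroup M] [Module K M] [LieRingModule L M]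
    [LieModule K L M] {h e f : L} {t : IsSl2Triple h e f} {m : M} {μ : K}
    (P : t.HasPrimitiveVectorWith m μ)
    (hf : ∃ n, (LieModule.toEnd K L M f ^ n) m = 0) : ∃ n : ℕ, μ = n := by
  obtain ⟨n, hn₁, hn₂⟩ := Nat.exists_not_and_succ_of_not_zero_of_exists P.ne_zero hf
  refine ⟨n, ?_⟩
  have := P.lie_e_pow_succ_toEnd_f n
  rw [hn₂, lie_zero, eq_comm, smul_eq_zero_iff_left hn₁, mul_eq_zero, sub_eq_zero] at this
  exact this.resolve_left <| Nat.cast_add_one_ne_zero n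

namespace PreT

variable {P : PreT}

lemma inΓ_zero : P.inΓ 0 := fun _ => dvd_zero _

lemma inΓ_neg {k : Fin P.n → ℤ} (h : P.inΓ k) : P.inΓ (-k) := fun i => (h i).neg_right

lemma mem_gr {k : Fin P.n → ℤ} {x : P.g} :
    x ∈ P.gr k ↔ ∀ i, P.σ i x = P.ξ i ^ (k i) • x := by
  simp [gr, sub_eq_zero]

lemma ξ_ne_zero (i : Fin P.n) : P.ξ i ≠ 0 := (P.ξprim i).ne_zero (P.mpos i).ne'

lemma lie_mem_gr {k l : Fin P.n → ℤ} {x y : P.g} (hx : x ∈ P.gr k) (hy : y ∈ P.gr l) :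
    ⁅x, y⁆ ∈ P.gr (k + l) := by
  rw [mem_gr] at *
  intro i
  rw [LieEquiv.map_lie, hx i, hy i, smul_lie, lie_smul, smul_smul, Pi.add_apply,
    zpow_add₀ (ξ_ne_zero i)]

lemma gr_le_gr_of_inΓ {k l : Fin P.n → ℤ} (h : P.inΓ (l - k)) : P.gr k ≤ P.gr l := by
  intro x hx
  rw [mem_gr] at *
  intro i
  have : P.ξ i ^ (l i) = P.ξ i ^ (k i) := by
    rw [show l i = (l i - k i) + k i by ring, zpow_add₀ (ξ_ne_zero i),
      ((P.ξprim i).zpow_eq_one_iff_dvd (l i - k i)).2 (h i), one_mul]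
  rw [hx i, this]

lemma gr_add_eq {r k : Fin P.n → ℤ} (h : P.inΓ r) : P.gr (r + k) = P.gr k :=
  le_antisymm (gr_le_gr_of_inΓ (by simpa using inΓ_neg h)) (gr_le_gr_of_inΓ (by simpa using h))

lemma inΓ_add_of_bil_ne_zero {k l : Fin P.n → ℤ} {x y : P.g} (hx : x ∈ P.gr k)
    (hy : y ∈ P.gr l) (h : P.bil x y ≠ 0) : P.inΓ (k + l) := by
  rw [mem_gr] at *
  intro i
  have := P.bil_aut i x y
  rw [hx i, hy i, map_smul, map_smul, LinearMap.smul_apply, smul_eq_mul, smul_eq_mul, ← mul_assoc,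
    ← zpow_add₀ (ξ_ne_zero i), mul_eq_right₀ h] at this
  rw [Pi.add_apply, ← (P.ξprim i).zpow_eq_one_iff_dvd]
  rwa [add_comm]

lemma iSup_gr_eq_top : ⨆ k, P.gr k = ⊤ := by
  have := P.gfin
  let f : Fin P.n → Module.End ℂ P.g := fun i => (P.σ i).toLinearEquiv.toLinearMap
  have hpow (i : Fin P.n) : f i ^ P.m i = 1 := by
    ext x
    rw [Module.End.pow_apply]
    exact P.σord i x
  have hss (i : Fin P.n) : (f i).IsSemisimple := by
    refine Module.End.isSemisimple_of_squarefree_aeval_eq_zero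
      (p := Polynomial.X ^ P.m i - 1) ?_ (by simp [hpow])
    refine Polynomial.Separable.squarefree (Polynomial.X_pow_sub_one_separable_iff.2 ?_)
    exact_mod_cast (P.mpos i).ne'
  have key := Module.End.le_iSup_inf_jointEigenspace (f := f) (p := ⊤)
    (fun i j => LinearMap.ext fun x => P.σcomm i j x) (fun _ _ _ => trivial)
    (fun i c x _ h => Module.End.eq_smul_of_sub_sq_apply_eq_zero
      (by rw [(hss i).iSup_eigenspace_eq_top]; trivial) h)
  rw [eq_top_iff]
  refine key.trans (iSup_le fun χ => ?_)
  rw [top_inf_eq]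
  by_cases hχ : Module.End.jointEigenspace f χ = ⊥
  · simp [hχ]
  obtain ⟨v, hv, hv0⟩ := Submodule.exists_mem_ne_zero_of_ne_bot hχ
  rw [Module.End.mem_jointEigenspace] at hv
  have hroot (i : Fin P.n) : ∃ k : ℕ, P.ξ i ^ k = χ i := by
    have h1 (N : ℕ) : (f i ^ N) v = χ i ^ N • v := by
      induction N with
      | zero => simp
      | succ N ih => rw [pow_succ', Module.End.mul_apply, ih, map_smul, hv, smul_smul, pow_succ]
    have h2 := h1 (P.m i)
    rw [hpow, Module.End.one_apply, eq_comm] at h2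
    have h3 : χ i ^ P.m i = 1 := by
      by_contra hne
      apply hv0
      have : (χ i ^ P.m i - 1) • v = 0 := by rw [sub_smul, h2, one_smul, sub_self]
      exact (smul_eq_zero.1 this).resolve_left (sub_ne_zero.2 hne)
    have : NeZero (P.m i) := ⟨(P.mpos i).ne'⟩
    obtain ⟨k, -, hk⟩ := (P.ξprim i).eq_pow_of_pow_eq_one h3
    exact ⟨k, hk⟩
  choose k hk using hroot
  refine le_iSup_of_le (fun i => (k i : ℤ)) fun x hx => ?_
  rw [Module.End.mem_jointEigenspace] at hx
  rw [mem_gr]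
  intro i
  rw [zpow_natCast, hk]
  exact hx i

end PreT

namespace Cartan

variable {P : PreT} {C : Cartan P}

lemma mem_wtfull {α : Module.Dual ℂ ↥C.h0} {x : P.g} :
    x ∈ C.wtfull α ↔ ∀ h : ↥C.h0, ⁅(h : P.g), x⁆ = α h • x := by
  simp [wtfull, sub_eq_zero]

lemma lie_mem_wtfull {α β : Module.Dual ℂ ↥C.h0} {x y : P.g} (hx : x ∈ C.wtfull α)
    (hy : y ∈ C.wtfull β) : ⁅x, y⁆ ∈ C.wtfull (α + β) := by
  rw [mem_wtfull] at *
  intro h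
  rw [leibniz_lie, hx, hy, smul_lie, lie_smul, LinearMap.add_apply, add_smul]

lemma lie_mem_wtg {k l : Fin P.n → ℤ} {α β : Module.Dual ℂ ↥C.h0} {x y : P.g}
    (hx : x ∈ C.wtg k α) (hy : y ∈ C.wtg l β) : ⁅x, y⁆ ∈ C.wtg (k + l) (α + β) :=
  ⟨PreT.lie_mem_gr hx.1 hy.1, lie_mem_wtfull hx.2 hy.2⟩

lemma wtg_add_eq {r k : Fin P.n → ℤ} (h : P.inΓ r) (α : Module.Dual ℂ ↥C.h0) :
    C.wtg (r + k) α = C.wtg k α := by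
  rw [wtg, PreT.gr_add_eq h, wtg]

lemma mem_wtg_zero_of_mem_h0 {h : P.g} (hh : h ∈ C.h0) : h ∈ C.wtg 0 0 :=
  ⟨C.h0_le hh, mem_wtfull.2 fun h' => by simp [C.h0_abelian h' h'.2 h hh]⟩

lemma mem_h0_of_mem_wtg_zero {h : P.g} (hh : h ∈ C.wtg 0 0) : h ∈ C.h0 :=
  C.h0_selfnorm h hh.1 fun h' hh' => by simp [mem_wtfull.1 hh.2 ⟨h', hh'⟩]

lemma bil_eq_zero {α β : Module.Dual ℂ ↥C.h0} {x y : P.g} (hx : x ∈ C.wtfull α)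
    (hy : y ∈ C.wtfull β) (h : α + β ≠ 0) : P.bil x y = 0 := by
  rw [mem_wtfull] at *
  by_contra hne
  apply h
  ext t
  have h1 := P.bil_invariant x t y
  rw [← lie_skew, hx, hy, map_neg, map_smul, map_smul, LinearMap.neg_apply, LinearMap.smul_apply,
    smul_eq_mul, smul_eq_mul, ← sub_eq_zero, ← neg_mul, ← sub_mul] at h1
  have := (mul_eq_zero.1 h1).resolve_right hne
  rw [LinearMap.add_apply, LinearMap.zero_apply]
  linear_combination -this

/-- The adjoint action of `h0` on the whole of `g`. -/
def adFamily (C : Cartan P) (h : ↥C.h0) : Module.End ℂ P.g := LieAlgebra.ad ℂ P.g h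

lemma commute_adFamily (h h' : ↥C.h0) : Commute (C.adFamily h) (C.adFamily h') := by
  refine LinearMap.ext fun x => ?_
  simp only [adFamily, Module.End.mul_apply, LieAlgebra.ad_apply]
  rw [leibniz_lie, C.h0_abelian h h.2 h' h'.2, zero_lie, zero_add]

lemma wtfull_eq (α : Module.Dual ℂ ↥C.h0) :
    C.wtfull α = Module.End.jointEigenspace C.adFamily α := by
  ext x
  rw [mem_wtfull, Module.End.mem_jointEigenspace]
  rfl

lemma iSupIndep_wtfull : iSupIndep C.wtfull := by
  have : C.wtfull = fun α : Module.Dual ℂ ↥C.h0 => Module.End.jointEigenspace C.adFamily α :=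
    funext fun α => wtfull_eq α
  rw [this]
  exact (Module.End.iSupIndep_jointEigenspace _ commute_adFamily).comp DFunLike.coe_injective

lemma finite_Δen : C.Δen.Finite := by
  have := P.gfin
  refine (WellFoundedGT.finite_ne_bot_of_iSupIndep (iSupIndep_wtfull (C := C))).subset ?_
  rintro α ⟨-, k, hk⟩ h
  exact hk (by rw [wtg, h, inf_bot_eq])

lemma gr_le_iSup_wtg {k : Fin P.n → ℤ}
    (h : ∀ t : ↥C.h0, ∀ c : ℂ, ∀ x ∈ P.gr k,
      ⁅(t : P.g), ⁅(t : P.g), x⁆ - c • x⁆ - c • (⁅(t : P.g), x⁆ - c • x) = 0 →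
        ⁅(t : P.g), x⁆ = c • x) :
    P.gr k ≤ ⨆ α, C.wtg k α := by
  have := P.gfin
  refine (Module.End.le_iSup_inf_jointEigenspace (f := C.adFamily) commute_adFamily
    (fun t x hx => ?_) (fun t c x hx h0 => h t c x hx ?_)).trans (iSup_le fun χ => ?_)
  · have := PreT.lie_mem_gr (C.h0_le t.2) hx
    rwa [zero_add] at this
  · simpa [adFamily] using h0
  · by_cases hχ : Module.End.jointEigenspace C.adFamily χ = ⊥
    · simp [hχ]
    obtain ⟨v, hv, hv0⟩ := Submodule.exists_mem_ne_zero_of_ne_bot hχ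
    rw [Module.End.mem_jointEigenspace] at hv
    let α : Module.Dual ℂ ↥C.h0 :=
      { toFun := χ
        map_add' := fun s t => by
          refine smul_left_injective ℂ hv0 ?_
          simp only [add_smul, ← hv]
          simp [adFamily]
        map_smul' := fun c t => by
          refine smul_left_injective ℂ hv0 ?_
          simp only [RingHom.id_apply, smul_eq_mul, mul_smul, ← hv]
          simp [adFamily] }
    refine le_iSup_of_le α ?_
    rw [wtg, wtfull_eq]
    exact le_rfl

end Cartan

namespace Torus

variable {P : PreT} {C : Cartan P} (T : Torus P C)
include T

lemma gr_le_iSup_wtg_of_not_inΓ {k : Fin P.n → ℤ} (hk : ¬ P.inΓ k) :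
    P.gr k ≤ ⨆ α, C.wtg k α := by
  by_cases hbot : P.gr k = ⊥
  · simp [hbot]
  obtain ⟨U, W, hU, hW, -, hsup, hUt, hW'⟩ := T.cond_M k hk hbot
  have hle : P.gr k ≤ ⨆ α, C.wtfull α := by
    rw [← hsup]
    refine sup_le (le_iSup_of_le 0 fun x hx => Cartan.mem_wtfull.2 fun h => ?_) ?_
    · rw [hUt _ (C.h0_le h.2) _ hx, LinearMap.zero_apply, zero_smul]
    · rcases hW' with rfl | ⟨-, -, h⟩
      · exact bot_le
      · exact h.trans (iSup₂_le fun α _ => le_iSup C.wtfull α)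
  refine Cartan.gr_le_iSup_wtg fun t c x hx h => ?_
  refine Module.End.eq_smul_of_sub_sq_apply_eq_zero (T := C.adFamily t) ?_
    (by simpa [Cartan.adFamily] using h)
  refine SetLike.le_def.1 (hle.trans (iSup_le fun α => le_iSup_of_le (α t) fun y hy => ?_)) hx
  rw [Module.End.mem_eigenspace_iff]
  exact Cartan.mem_wtfull.1 hy t

end Torus

namespace Cartan

variable {P : PreT} {C : Cartan P}

lemma exists_bil_ne_zero (hD : ∀ k, P.gr k ≤ ⨆ α, C.wtg k α) {k : Fin P.n → ℤ}
    {α : Module.Dual ℂ ↥C.h0} {x : P.g} (hx : x ∈ C.wtg k α) (hx0 : x ≠ 0) :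
    ∃ z ∈ C.wtg (-k) (-α), P.bil x z ≠ 0 := by
  by_contra! hcon
  refine hx0 (P.bil_nondeg x fun y => ?_)
  have htop : (⊤ : Submodule ℂ P.g) ≤ LinearMap.ker (P.bil x) := by
    rw [← PreT.iSup_gr_eq_top]
    refine iSup_le fun l => (hD l).trans (iSup_le fun β z hz => ?_)
    rw [LinearMap.mem_ker]
    by_contra hne
    have hαβ : α + β = 0 := by
      by_contra h
      exact hne (bil_eq_zero hx.2 hz.2 h)
    obtain rfl : β = -α := (neg_eq_of_add_eq_zero_right hαβ).symm
    refine hne (hcon z ?_)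
    have := wtg_add_eq (C := C) (PreT.inΓ_add_of_bil_ne_zero hx.1 hz.1 hne) (k := -k) (-α)
    rw [← this]
    simpa using hz
  exact htop trivial

lemma eq_zero_of_bil_h0_eq_zero (hD : ∀ k, P.gr k ≤ ⨆ α, C.wtg k α) {h : P.g} (hh : h ∈ C.h0)
    (h0 : ∀ h' ∈ C.h0, P.bil h h' = 0) : h = 0 := by
  by_contra hne
  obtain ⟨z, hz, hz0⟩ := exists_bil_ne_zero hD (mem_wtg_zero_of_mem_h0 hh) hne
  rw [neg_zero, neg_zero] at hz
  exact hz0 (h0 z (mem_h0_of_mem_wtg_zero hz))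

end Cartan

namespace Torus

variable {P : PreT} {C : Cartan P} (T : Torus P C)

lemma coroot_ne_zero {α : Module.Dual ℂ ↥C.h0} (hα : α ∈ C.Δen) : (T.coroot α : P.g) ≠ 0 := by
  intro h
  have := T.coroot_two α hα
  rw [(Subtype.ext h : T.coroot α = 0), map_zero] at this
  norm_num at this

lemma exists_lie_eq_coroot (hD : ∀ k, P.gr k ≤ ⨆ α, C.wtg k α) {k : Fin P.n → ℤ}
    {α : Module.Dual ℂ ↥C.h0} (hα : α ∈ C.Δen) {x : P.g} (hx : x ∈ C.wtg k α) (hx0 : x ≠ 0) :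
    ∃ y ∈ C.wtg (-k) (-α), ⁅x, y⁆ = (T.coroot α : P.g) := by
  obtain ⟨z, hz, hz0⟩ := Cartan.exists_bil_ne_zero hD hx hx0
  have hxz : ⁅x, z⁆ ∈ C.h0 := by
    refine Cartan.mem_h0_of_mem_wtg_zero ?_
    simpa using Cartan.lie_mem_wtg hx hz
  refine ⟨(T.cnorm α / P.bil x z) • z, Submodule.smul_mem _ _ hz, ?_⟩
  rw [← sub_eq_zero]
  refine Cartan.eq_zero_of_bil_h0_eq_zero hD
    (sub_mem (by rw [lie_smul]; exact Submodule.smul_mem _ _ hxz) (T.coroot α).2) fun h hh => ?_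
  have h1 : P.bil ⁅x, z⁆ h = α ⟨h, hh⟩ * P.bil x z := by
    rw [P.bil_invariant, ← lie_skew, Cartan.mem_wtfull.1 hz.2 ⟨h, hh⟩]
    simp
  have h2 := T.cnorm_spec α hα ⟨h, hh⟩
  rw [map_sub, LinearMap.sub_apply, h2, lie_smul, map_smul, LinearMap.smul_apply, h1, smul_eq_mul]
  field_simp
  ring

lemma isSl2Triple {k : Fin P.n → ℤ} {α : Module.Dual ℂ ↥C.h0} (hα : α ∈ C.Δen) {x y : P.g}
    (hx : x ∈ C.wtg k α) (hy : y ∈ C.wtg (-k) (-α)) (hxy : ⁅x, y⁆ = (T.coroot α : P.g)) :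
    IsSl2Triple (T.coroot α : P.g) x y where
  h_ne_zero := T.coroot_ne_zero hα
  lie_e_f := hxy
  lie_h_e_nsmul := by
    rw [Cartan.mem_wtfull.1 hx.2, T.coroot_two α hα, two_smul, two_smul]
  lie_h_f_nsmul := by
    rw [Cartan.mem_wtfull.1 hy.2, LinearMap.neg_apply, T.coroot_two α hα, neg_smul, two_smul,
      two_smul]

lemma add_eq_zero_or_mem_Δen (hD : ∀ k, P.gr k ≤ ⨆ α, C.wtg k α) {α β : Module.Dual ℂ ↥C.h0}
    (hα : α ∈ C.Δen) (hβ : β ∈ C.Δen) (h : ¬ ∃ n : ℕ, β (T.coroot α) = n) :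
    α + β = 0 ∨ α + β ∈ C.Δen := by
  have := P.gfin
  rw [or_iff_not_imp_left]
  intro hne
  refine ⟨hne, ?_⟩
  obtain ⟨-, k, hk⟩ := id hα
  obtain ⟨x, hx, hx0⟩ := Submodule.exists_mem_ne_zero_of_ne_bot hk
  obtain ⟨-, l, hl⟩ := hβ
  obtain ⟨v, hv, hv0⟩ := Submodule.exists_mem_ne_zero_of_ne_bot hl
  obtain ⟨y, hy, hxy⟩ := T.exists_lie_eq_coroot hD hα hx hx0
  refine ⟨k + l, fun hbot => h ?_⟩
  have hxv := Cartan.lie_mem_wtg hx hv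
  rw [hbot, Submodule.mem_bot] at hxv
  have hp : (T.isSl2Triple hα hx hy hxy).HasPrimitiveVectorWith v (β (T.coroot α)) :=
    ⟨hv0, Cartan.mem_wtfull.1 hv.2 _, hxv⟩
  exact hp.exists_nat

lemma multiset_sum_ne_zero (hD : ∀ k, P.gr k ≤ ⨆ α, C.wtg k α) (n : ℕ) :
    ∀ s : Multiset (Module.Dual ℂ ↥C.h0), s.card = n + 1 → (∀ a ∈ s, a ∈ T.pos) → s.sum ≠ 0 := by
  induction n with
  | zero =>
    intro s hs hpos
    obtain ⟨a, rfl⟩ := Multiset.card_eq_one.1 hs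
    rw [Multiset.sum_singleton]
    exact (T.pos_sub (hpos a (by simp))).1
  | succ n ih =>
    intro s hs hpos hsum
    obtain ⟨a, ha⟩ := Multiset.card_pos_iff_exists_mem.1 (by omega : 0 < s.card)
    obtain ⟨t, rfl⟩ := Multiset.exists_cons_of_mem ha
    replace ha : a ∈ T.pos := hpos a ha
    have haΔ := T.pos_sub ha
    by_cases hall : ∀ b ∈ t, ∃ n : ℕ, b (T.coroot a) = n
    · have key : ∀ u : Multiset (Module.Dual ℂ ↥C.h0), (∀ b ∈ u, ∃ n : ℕ, b (T.coroot a) = n) →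
          ∃ n : ℕ, u.sum (T.coroot a) = n := by
        intro u
        induction u using Multiset.induction_on with
        | empty => exact fun _ => ⟨0, by simp⟩
        | cons b u ihu =>
          intro hu
          obtain ⟨p, hp⟩ := hu b (Multiset.mem_cons_self b u)
          obtain ⟨q, hq⟩ := ihu fun b hb => hu b (Multiset.mem_cons_of_mem hb)
          exact ⟨p + q, by simp [hp, hq]⟩
      obtain ⟨N, hN⟩ := key t hall
      have := LinearMap.congr_fun hsum (T.coroot a)
      rw [Multiset.sum_cons, LinearMap.add_apply, T.coroot_two a haΔ, hN, LinearMap.zero_apply]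
        at this
      norm_cast at this
      omega
    · push Not at hall
      obtain ⟨b, hb, hbn⟩ := hall
      obtain ⟨u, rfl⟩ := Multiset.exists_cons_of_mem hb
      have hbpos : b ∈ T.pos := hpos b (by simp)
      have hab : a + b ∈ T.pos := by
        refine T.pos_add a ha b hbpos ?_
        refine (T.add_eq_zero_or_mem_Δen hD haΔ (T.pos_sub hbpos)
          (by simpa using hbn)).resolve_left fun h => ?_
        rw [← neg_eq_of_add_eq_zero_right h] at hbpos
        exact T.pos_disj a ha hbpos
      refine ih ((a + b) ::ₘ u) (by simpa using hs) (fun c hc => ?_) ?_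
      · rcases Multiset.mem_cons.1 hc with rfl | hc
        · exact hab
        · exact hpos c (by simp [hc])
      · simpa [add_assoc] using hsum

/-- The cone of sums of positive roots. -/
def posCone : AddSubmonoid (Module.Dual ℂ ↥C.h0) := AddSubmonoid.closure T.pos

lemma mem_posCone_of_mem_pos {α : Module.Dual ℂ ↥C.h0} (h : α ∈ T.pos) : α ∈ T.posCone :=
  AddSubmonoid.subset_closure h

lemma eq_zero_of_add_eq_zero (hD : ∀ k, P.gr k ≤ ⨆ α, C.wtg k α) {a b : Module.Dual ℂ ↥C.h0}
    (ha : a ∈ T.posCone) (hb : b ∈ T.posCone) (hab : a + b = 0) : a = 0 := by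
  obtain ⟨s, hs, rfl⟩ := AddSubmonoid.exists_multiset_of_mem_closure ha
  obtain ⟨t, ht, rfl⟩ := AddSubmonoid.exists_multiset_of_mem_closure hb
  by_contra hne
  have hs0 : s ≠ 0 := by rintro rfl; exact hne rfl
  have hst : (s + t).card ≠ 0 := by
    rw [Multiset.card_add]
    have := Multiset.card_pos.2 hs0
    omega
  obtain ⟨n, hn⟩ := Nat.exists_eq_succ_of_ne_zero hst
  refine T.multiset_sum_ne_zero hD n (s + t) hn (fun a ha => ?_) (by rw [Multiset.sum_add, hab])
  rcases Multiset.mem_add.1 ha with h | h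
  · exact hs a h
  · exact ht a h

end Torus

namespace Toroidal

variable {P : PreT} {C : Cartan P} {T : Torus P C} (X : Toroidal P C T)

lemma lie_E_zero_E {k : Fin P.n → ℤ} {x y : P.g} (hx : x ∈ P.gr 0) (hy : y ∈ P.gr k) :
    ⁅X.E 0 x, X.E k y⁆ = X.E k ⁅x, y⁆ := by
  rw [X.br_EE 0 k x y hx hy]
  simp

lemma lie_E_h0_E {k : Fin P.n → ℤ} {α : Module.Dual ℂ ↥C.h0} (h : ↥C.h0) {x : P.g}
    (hx : x ∈ C.wtg k α) : ⁅X.E 0 (h : P.g), X.E k x⁆ = α h • X.E k x := by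
  rw [X.lie_E_zero_E (C.h0_le h.2) hx.1, Cartan.mem_wtfull.1 hx.2 h, map_smul]

lemma lie_Dop_zero_E {k : Fin P.n → ℤ} {x : P.g} (hx : x ∈ P.gr k) (i : Fin P.n) :
    ⁅X.Dop 0 i, X.E k x⁆ = (k i : ℂ) • X.E k x := by
  simpa using X.br_DE 0 PreT.inΓ_zero i k x hx

lemma lie_Dop_zero_K {r : Fin P.n → ℤ} (hr : P.inΓ r) (i j : Fin P.n) :
    ⁅X.Dop 0 i, X.K r j⁆ = (r i : ℂ) • X.K r j := by
  simpa using X.br_DK 0 r PreT.inΓ_zero hr i j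

lemma lie_Dop_zero_Dop {r : Fin P.n → ℤ} (hr : P.inΓ r) (i j : Fin P.n) :
    ⁅X.Dop 0 i, X.Dop r j⁆ = (r i : ℂ) • X.Dop r j := by
  simpa using X.br_DD 0 r PreT.inΓ_zero hr i j

end Toroidal

namespace TRep

variable {P : PreT} {C : Cartan P} {T : Torus P C} {X : Toroidal P C T} (M : TRep X)

lemma ρ_apply_ρ_apply (a b : X.τ) (v : M.V) :
    M.ρ a (M.ρ b v) = M.ρ b (M.ρ a v) + M.ρ ⁅a, b⁆ v := by
  simp [M.ρ_lie]

lemma ρ_apply_eq_smul_add {a b : X.τ} {c d : ℂ} {v : M.V} (hab : ⁅a, b⁆ = c • b)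
    (hv : M.ρ a v = d • v) : M.ρ a (M.ρ b v) = (d + c) • M.ρ b v := by
  rw [ρ_apply_ρ_apply, hv, hab, map_smul, map_smul, LinearMap.smul_apply, add_smul]

/-- The commuting operators on the module given by the elements of `𝔥_{0̄}`. -/
def hFamily (h : ↥C.h0) : Module.End ℂ M.V := M.ρ (X.E 0 (h : P.g))

/-- The weight spaces for `𝔥_{0̄}` alone. -/
def hEig (lam : Module.Dual ℂ ↥C.h0) : Submodule ℂ M.V :=
  Module.End.jointEigenspace M.hFamily lam

variable {M}

lemma mem_hEig {lam : Module.Dual ℂ ↥C.h0} {v : M.V} :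
    v ∈ M.hEig lam ↔ ∀ h : ↥C.h0, M.ρ (X.E 0 (h : P.g)) v = lam h • v :=
  Module.End.mem_jointEigenspace

lemma commute_hFamily (h h' : ↥C.h0) : Commute (M.hFamily h) (M.hFamily h') := by
  rw [Commute, SemiconjBy, ← sub_eq_zero, hFamily, hFamily, ← M.ρ_lie,
    X.lie_E_zero_E (C.h0_le h.2) (C.h0_le h'.2), C.h0_abelian h h.2 h' h'.2, map_zero, map_zero]

lemma iSupIndep_hEig : iSupIndep M.hEig :=
  (Module.End.iSupIndep_jointEigenspace _ commute_hFamily).comp DFunLike.coe_injective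

lemma dEig_eq (b : Fin P.n → ℂ) :
    M.dEig b = Module.End.jointEigenspace (fun i => M.ρ (X.Dop 0 i)) b := by
  ext v
  simp [dEig, Module.End.mem_jointEigenspace, sub_eq_zero]

lemma mem_dEig {b : Fin P.n → ℂ} {v : M.V} :
    v ∈ M.dEig b ↔ ∀ i, M.ρ (X.Dop 0 i) v = b i • v := by
  rw [dEig_eq, Module.End.mem_jointEigenspace]

lemma iSupIndep_dEig : iSupIndep M.dEig := by
  rw [show M.dEig = _ from funext dEig_eq]
  refine Module.End.iSupIndep_jointEigenspace _ fun i j => ?_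
  rw [Commute, SemiconjBy, ← sub_eq_zero, ← M.ρ_lie, X.lie_Dop_zero_Dop PreT.inΓ_zero]
  simp

lemma mem_wtSp {w : C.Wt} {v : M.V} :
    v ∈ M.wtSp w ↔ v ∈ M.hEig w.1 ∧ (∀ i, M.ρ (X.K 0 i) v = w.2.1 i • v) ∧ v ∈ M.dEig w.2.2 := by
  simp [wtSp, mem_hEig, mem_dEig, sub_eq_zero, and_assoc]

lemma wtSp_le_hEig (w : C.Wt) : M.wtSp w ≤ M.hEig w.1 := fun _ hv => (mem_wtSp.1 hv).1

lemma wtSp_le_dEig (w : C.Wt) : M.wtSp w ≤ M.dEig w.2.2 := fun _ hv => (mem_wtSp.1 hv).2.2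

lemma LevelZero.snd_eq_zero (hlz : M.LevelZero) {w : C.Wt} {v : M.V} (hv : v ∈ M.wtSp w)
    (hv0 : v ≠ 0) : w.2.1 = 0 := by
  ext i
  have := (mem_wtSp.1 hv).2.1 i
  rw [hlz i, LinearMap.zero_apply, eq_comm, smul_eq_zero] at this
  exact this.resolve_right hv0

lemma LevelZero.mem_wtSp (hlz : M.LevelZero) {lam : Module.Dual ℂ ↥C.h0} {b : Fin P.n → ℂ}
    {v : M.V} : v ∈ M.wtSp (lam, 0, b) ↔ v ∈ M.hEig lam ∧ v ∈ M.dEig b := by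
  rw [TRep.mem_wtSp]
  simp [hlz _]

lemma E_mem_hEig {k : Fin P.n → ℤ} {α lam : Module.Dual ℂ ↥C.h0} {x : P.g} {v : M.V}
    (hx : x ∈ C.wtg k α) (hv : v ∈ M.hEig lam) : M.ρ (X.E k x) v ∈ M.hEig (lam + α) :=
  mem_hEig.2 fun h => M.ρ_apply_eq_smul_add (X.lie_E_h0_E h hx) (mem_hEig.1 hv h)

lemma mem_dEig_add {t : X.τ} {k : Fin P.n → ℤ} (ht : ∀ i, ⁅X.Dop 0 i, t⁆ = (k i : ℂ) • t)
    {b : Fin P.n → ℂ} {v : M.V} (hv : v ∈ M.dEig b) : M.ρ t v ∈ M.dEig (fun i => b i + k i) :=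
  mem_dEig.2 fun i => M.ρ_apply_eq_smul_add (ht i) (mem_dEig.1 hv i)

lemma E_mem_dEig {k : Fin P.n → ℤ} {x : P.g} (hx : x ∈ P.gr k) {b : Fin P.n → ℂ} {v : M.V}
    (hv : v ∈ M.dEig b) : M.ρ (X.E k x) v ∈ M.dEig (fun i => b i + k i) :=
  mem_dEig_add (X.lie_Dop_zero_E hx) hv

lemma LevelZero.E_mem_wtSp (hlz : M.LevelZero) {k : Fin P.n → ℤ}
    {α lam lam' : Module.Dual ℂ ↥C.h0} {b b' : Fin P.n → ℂ} {x : P.g} {v : M.V}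
    (hx : x ∈ C.wtg k α) (hv : v ∈ M.wtSp (lam, 0, b)) (hlam : lam + α = lam')
    (hb : ∀ i, b i + k i = b' i) : M.ρ (X.E k x) v ∈ M.wtSp (lam', 0, b') := by
  rw [hlz.mem_wtSp] at *
  exact ⟨hlam ▸ E_mem_hEig hx hv.1, funext hb ▸ E_mem_dEig hx.1 hv.2⟩

lemma mapsTo_of_mem_span {S : Set X.τ} {U W : Submodule ℂ M.V}
    (h : ∀ t ∈ S, ∀ v ∈ U, M.ρ t v ∈ W) :
    ∀ t ∈ Submodule.span ℂ S, ∀ v ∈ U, M.ρ t v ∈ W := by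
  intro t ht v hv
  induction ht using Submodule.span_induction with
  | mem t ht => exact h t ht v hv
  | zero => simp
  | add a b _ _ ha hb => simpa using W.add_mem ha hb
  | smul c a _ ha => simpa using W.smul_mem c ha

lemma Irr.eq_top_of_mapsTo (hirr : M.Irr) {S : Set X.τ} (hS : Submodule.span ℂ S = ⊤)
    {U : Submodule ℂ M.V} (hU : U ≠ ⊥) (h : ∀ t ∈ S, ∀ v ∈ U, M.ρ t v ∈ U) : U = ⊤ :=
  (hirr.2 U fun t => mapsTo_of_mem_span h t (hS ▸ Submodule.mem_top)).resolve_left hU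

lemma mapsTo_iSup {ι : Type*} {N : ι → Submodule ℂ M.V} {U : Submodule ℂ M.V}
    {f : Module.End ℂ M.V} (h : ∀ i, ∀ v ∈ N i, f v ∈ U) : ∀ v ∈ ⨆ i, N i, f v ∈ U :=
  fun _ hv => (iSup_le h : ⨆ i, N i ≤ U.comap f) hv

lemma Irr.iSup_dEig_eq_top (hirr : M.Irr) {b : Fin P.n → ℂ} (hb : M.dEig b ≠ ⊥) :
    ⨆ k : Fin P.n → ℤ, M.dEig (fun i => b i + k i) = ⊤ := by
  refine hirr.eq_top_of_mapsTo X.span_top (fun h => hb ?_) fun t ht => ?_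
  · have := iSup_eq_bot.1 h 0
    simpa using this
  have key : ∃ l : Fin P.n → ℤ, ∀ i, ⁅X.Dop 0 i, t⁆ = (l i : ℂ) • t := by
    rcases ht with (⟨k, x, hx, rfl⟩ | ⟨r, j, hr, rfl⟩) | ⟨r, j, hr, rfl⟩
    · exact ⟨k, X.lie_Dop_zero_E hx⟩
    · exact ⟨r, fun i => X.lie_Dop_zero_K hr i j⟩
    · exact ⟨r, fun i => X.lie_Dop_zero_Dop hr i j⟩
  obtain ⟨l, hl⟩ := key
  refine mapsTo_iSup fun k v hv => ?_
  refine Submodule.mem_iSup_of_mem (k + l) ?_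
  simpa [add_assoc] using mem_dEig_add hl hv

lemma _root_.iSupIndep.exists_eq_of_ne_bot {ι κ α : Type*} [CompleteLattice α] {N : ι → α}
    (hN : iSupIndep N) {f : κ → ι} (hf : ⨆ k, N (f k) = ⊤) {i : ι} (hi : N i ≠ ⊥) :
    ∃ k, i = f k := by
  by_contra! h
  refine hi (disjoint_self.1 ((hN i).mono_right ?_))
  refine le_top.trans (hf ▸ iSup_le fun k => le_iSup₂_of_le (f k) (h k).symm le_rfl)

lemma Irr.exists_eq_add_of_dEig_ne_bot (hirr : M.Irr) {b c : Fin P.n → ℂ} (hb : M.dEig b ≠ ⊥)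
    (hc : M.dEig c ≠ ⊥) : ∃ r : Fin P.n → ℤ, c = fun i => b i + r i :=
  iSupIndep_dEig.exists_eq_of_ne_bot (hirr.iSup_dEig_eq_top hb) hc

lemma Irr.exists_wtSp_ne_bot (hirr : M.Irr) (hw : M.IsWeight) : ∃ w, M.wtSp w ≠ ⊥ := by
  have := hirr.1
  by_contra! h
  have := hw.symm.trans (iSup_eq_bot.2 h)
  exact top_ne_bot this

lemma IsWeight.iSup_hEig_eq_top (hw : M.IsWeight) : ⨆ lam, M.hEig lam = ⊤ := by
  refine top_le_iff.1 (hw ▸ iSup_le fun w => ?_)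
  exact (wtSp_le_hEig w).trans (le_iSup M.hEig w.1)

/-- If `𝔤_{0̄}` acts faithfully, then `𝔤` is the sum of its root spaces. -/
lemma IsWeight.gr_le_iSup_wtg (hw : M.IsWeight)
    (hfaith : ∀ x ∈ P.gr 0, M.ρ (X.E 0 x) = 0 → x = 0) (k : Fin P.n → ℤ) :
    P.gr k ≤ ⨆ α, C.wtg k α := by
  by_cases hk : P.inΓ k
  · have h0 : P.gr 0 ≤ ⨆ α, C.wtg 0 α := by
      refine Cartan.gr_le_iSup_wtg fun t c x hx hy => ?_
      have ht := C.h0_le t.2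
      have htx : ⁅(t : P.g), x⁆ - c • x ∈ P.gr 0 :=
        sub_mem (by simpa using PreT.lie_mem_gr ht hx) (Submodule.smul_mem _ _ hx)
      rw [← sub_eq_zero]
      refine hfaith _ htx ?_
      set y := ⁅(t : P.g), x⁆ - c • x with hydef
      have hHX : ⁅X.E 0 (t : P.g), X.E 0 x⁆ = c • X.E 0 x + X.E 0 y := by
        rw [X.lie_E_zero_E ht hx, hydef]
        simp
      have hHY : ⁅X.E 0 (t : P.g), X.E 0 y⁆ = c • X.E 0 y := by
        rw [X.lie_E_zero_E ht htx, ← map_smul, ← sub_eq_zero, ← map_sub, hy, map_zero]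
      suffices h : (⊤ : Submodule ℂ M.V) ≤ LinearMap.ker (M.ρ (X.E 0 y)) from
        LinearMap.ker_eq_top.1 (top_le_iff.1 h)
      rw [← hw.iSup_hEig_eq_top]
      refine iSup_le fun lam v hv => ?_
      have hv' := mem_hEig.1 hv t
      have h1 : (M.ρ (X.E 0 (t : P.g)) - algebraMap ℂ _ (lam t + c)) (M.ρ (X.E 0 x) v) =
          M.ρ (X.E 0 y) v := by
        rw [LinearMap.sub_apply, ρ_apply_ρ_apply, hv', hHX]
        simp only [Module.algebraMap_end_apply, map_smul, map_add, LinearMap.add_apply,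
          LinearMap.smul_apply]
        abel
      have h2 : (M.ρ (X.E 0 (t : P.g)) - algebraMap ℂ _ (lam t + c)) (M.ρ (X.E 0 y) v) = 0 := by
        rw [LinearMap.sub_apply, M.ρ_apply_eq_smul_add hHY hv']
        simp [add_smul]
      have hmem : M.ρ (X.E 0 x) v ∈ ⨆ a, (M.ρ (X.E 0 (t : P.g))).eigenspace a := by
        have : (⊤ : Submodule ℂ M.V) ≤ ⨆ a, (M.ρ (X.E 0 (t : P.g))).eigenspace a := by
          rw [← hw.iSup_hEig_eq_top]
          exact iSup_le fun lam => le_iSup_of_le (lam t) (iInf_le _ t)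
        exact this trivial
      have := Module.End.eq_smul_of_sub_sq_apply_eq_zero hmem (by rw [h1, h2])
      rw [LinearMap.mem_ker, ← h1, LinearMap.sub_apply, this]
      simp [add_smul]
    have hgr (α) : C.wtg k α = C.wtg 0 α := by simpa using Cartan.wtg_add_eq hk (k := 0) α
    simp only [hgr]
    rwa [show P.gr k = P.gr 0 by simpa using PreT.gr_add_eq hk (k := 0)]
  · exact T.gr_le_iSup_wtg_of_not_inΓ hk

end TRep

section StringFiniteness

attribute [local instance] LieRing.ofAssociativeRing

open Module.End in
/-- In an integrable module over an `sl₂` triple, a string of weight vectors one of whose weight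
spaces is finite-dimensional is bounded above. -/
lemma IsSl2Triple.exists_forall_eq_bot {V : Type*} [AddCommGroup V] [Module ℂ V]
    {h e f : Module.End ℂ V} (t : IsSl2Triple h e f) {c : ℂ} {W : ℕ → Submodule ℂ V}
    [FiniteDimensional ℂ (W 0)] (hW : ∀ j, ∀ v ∈ W j, h v = (c + 2 * j) • v)
    (he : ∀ j, ∀ v ∈ W j, e v ∈ W (j + 1)) (hf : ∀ j, ∀ v ∈ W (j + 1), f v ∈ W j)
    (hen : ∀ v, ∃ n, (e ^ n) v = 0) (hfn : ∀ v, ∃ n, (f ^ n) v = 0) :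
    ∃ J, ∀ j ≥ J, W j = ⊥ := by
  obtain ⟨N, hN⟩ := exists_nat_gt ‖c‖
  have hc (j : ℕ) (hj : N ≤ j) : c ≠ -j := by
    rintro rfl
    rw [norm_neg, Complex.norm_natCast] at hN
    exact absurd hj (by exact_mod_cast hN.not_ge)
  have hW0 : ∀ v ∈ W 0, (f * e) v ∈ W 0 := fun v hv => hf 0 _ (he 0 v hv)
  let F : Module.End ℂ (W 0) := (f * e).restrict hW0
  have hfin : {j : ℕ | N ≤ j ∧ F.HasEigenvalue (j * (c + j + 1))}.Finite := by
    refine Set.Finite.of_injOn (f := fun j : ℕ => (j : ℂ) * (c + j + 1)) (fun j hj => hj.2) ?_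
      (finite_hasEigenvalue F)
    rintro i ⟨hi, -⟩ j ⟨hj, -⟩ hij
    have : ((i : ℂ) - j) * (c + (i + j + 1)) = 0 := by
      dsimp only at hij
      linear_combination hij
    rcases mul_eq_zero.1 this with h0 | h0
    · exact_mod_cast sub_eq_zero.1 h0
    · refine absurd (eq_neg_of_add_eq_zero_left h0) ?_
      exact_mod_cast hc (i + j + 1) (by omega)
  obtain ⟨B, hB⟩ := hfin.bddAbove
  have key (j : ℕ) (hjN : N ≤ j) (v : V) (hv : v ∈ W j) (hv0 : v ≠ 0) (hev : e v = 0) :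
      j ≤ B ∨ j = 0 := by
    have P : t.HasPrimitiveVectorWith v (c + 2 * j) := ⟨hv0, hW j v hv, hev⟩
    obtain ⟨m, hm⟩ := P.exists_nat_of_pow_eq_zero (K := ℂ) (hfn v)
    have hef (n : ℕ) : e ((f ^ (n + 1)) v) = ((n + 1) * (c + 2 * j - n)) • (f ^ n) v :=
      P.lie_e_pow_succ_toEnd_f n
    have hmj : j ≤ m := by
      by_contra! hlt
      refine hc (2 * j - m) (by omega) ?_
      rw [Nat.cast_sub (by omega)]
      push_cast
      linear_combination hm
    have hpow (n : ℕ) : n ≤ m → (f ^ n) v ≠ 0 := by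
      induction n with
      | zero => simpa using hv0
      | succ n ih =>
        intro hn h0
        have := hef n
        rw [h0, map_zero, eq_comm, smul_eq_zero, or_iff_left (ih (by omega)), mul_eq_zero,
          or_iff_right (Nat.cast_add_one_ne_zero n), hm, sub_eq_zero] at this
        have := Nat.cast_injective this
        omega
    have hmem (n : ℕ) : n ≤ j → (f ^ n) v ∈ W (j - n) := by
      induction n with
      | zero => simpa using hv
      | succ n ih =>
        intro hn
        rw [pow_succ', Module.End.mul_apply]
        refine hf _ _ ?_
        rw [show j - (n + 1) + 1 = j - n by omega]
        exact ih (by omega)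
    rcases j with _ | j
    · exact Or.inr rfl
    refine Or.inl (hB ⟨hjN, ?_⟩)
    have hmem0 : (f ^ (j + 1)) v ∈ W 0 := by simpa using hmem (j + 1) le_rfl
    refine hasEigenvalue_of_hasEigenvector (x := ⟨_, hmem0⟩)
      (hasEigenvector_iff.2 ⟨mem_eigenspace_iff.2 (Subtype.ext ?_), fun h0 =>
      hpow _ hmj (congrArg Subtype.val h0)⟩)
    change f (e ((f ^ (j + 1)) v)) = _ • (f ^ (j + 1)) v
    rw [hef, map_smul, ← Module.End.mul_apply, ← pow_succ']
    congr 1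
    push_cast
    ring
  refine ⟨N + B + 1, fun j hj => ?_⟩
  by_contra hbot
  obtain ⟨v, hv, hv0⟩ := Submodule.exists_mem_ne_zero_of_ne_bot hbot
  obtain ⟨n, hn⟩ := hen v
  clear hbot
  induction n generalizing j v with
  | zero => exact hv0 (by simpa using hn)
  | succ n ih =>
    by_cases hev : e v = 0
    · have := key j (by omega) v hv hv0 hev
      omega
    · exact ih (j + 1) (by omega) (e v) (he j v hv) hev (by rwa [pow_succ] at hn)

lemma IsSl2Triple.eq_zero_of_apply_f_eq_zero {V : Type*} [AddCommGroup V] [Module ℂ V]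
    {h e f : Module.End ℂ V} (t : IsSl2Triple h e f) {c : ℂ} (hen : ∀ v, ∃ n, (e ^ n) v = 0)
    (hc : ∀ n : ℕ, c ≠ -n) {v : V} (hv : h v = c • v) (hfv : f v = 0) : v = 0 := by
  by_contra hv0
  have P : t.symm.HasPrimitiveVectorWith v (-c) := ⟨hv0, by simp [hv], hfv⟩
  obtain ⟨n, hn⟩ := P.exists_nat_of_pow_eq_zero (K := ℂ) (hen v)
  exact hc n (neg_eq_iff_eq_neg.1 hn)

namespace TRep

variable {P : PreT} {C : Cartan P} {T : Torus P C} {X : Toroidal P C T} {M : TRep X}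

lemma LevelZero.isSl2Triple (hlz : M.LevelZero)
    (hfaith : ∀ x ∈ P.gr 0, M.ρ (X.E 0 x) = 0 → x = 0)
    {k : Fin P.n → ℤ} {α : Module.Dual ℂ ↥C.h0} (hα : α ∈ C.Δen) {x y : P.g}
    (hx : x ∈ C.wtg k α) (hy : y ∈ C.wtg (-k) (-α)) (hxy : ⁅x, y⁆ = (T.coroot α : P.g)) :
    IsSl2Triple (M.ρ (X.E 0 (T.coroot α : P.g))) (M.ρ (X.E k x)) (M.ρ (X.E (-k) y)) where
  h_ne_zero h := T.coroot_ne_zero hα (hfaith _ (C.h0_le (T.coroot α).2) h)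
  lie_e_f := by
    rw [LieRing.of_associative_ring_bracket, ← M.ρ_lie, X.br_EE k (-k) x y hx.1 hy.1, hxy,
      add_neg_cancel, map_add, map_smul, map_sum]
    simp [hlz _]
  lie_h_e_nsmul := by
    rw [LieRing.of_associative_ring_bracket, ← M.ρ_lie, X.lie_E_h0_E _ hx, T.coroot_two α hα,
      map_smul, ofNat_smul_eq_nsmul]
  lie_h_f_nsmul := by
    rw [LieRing.of_associative_ring_bracket, ← M.ρ_lie, X.lie_E_h0_E _ hy, LinearMap.neg_apply,
      T.coroot_two α hα, map_smul, neg_smul, ofNat_smul_eq_nsmul]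

end TRep

end StringFiniteness

namespace TRep

variable {P : PreT} {C : Cartan P} {T : Torus P C} {X : Toroidal P C T} {M : TRep X}

lemma LevelZero.exists_forall_wtSp_eq_bot_of_mem (hlz : M.LevelZero) (hint : M.Integrable)
    (hfin : M.FinWt) (hfaith : ∀ x ∈ P.gr 0, M.ρ (X.E 0 x) = 0 → x = 0)
    {α : Module.Dual ℂ ↥C.h0} (hα : α ∈ C.Δen) {k : Fin P.n → ℤ} {x y : P.g}
    (hx : x ∈ C.wtg k α) (hy : y ∈ C.wtg (-k) (-α)) (hxy : ⁅x, y⁆ = (T.coroot α : P.g))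
    (lam : Module.Dual ℂ ↥C.h0) (b : Fin P.n → ℂ) :
    ∃ J : ℕ, ∀ j ≥ J, M.wtSp (lam + j • α, 0, fun i => b i + j * k i) = ⊥ := by
  let W (j : ℕ) : Submodule ℂ M.V := M.wtSp (lam + j • α, 0, fun i => b i + j * k i)
  have : FiniteDimensional ℂ (W 0) := hfin _
  refine (hlz.isSl2Triple hfaith hα hx hy hxy).exists_forall_eq_bot (c := lam (T.coroot α))
    (W := W) (fun j v hv => ?_) (fun j v hv => ?_) (fun j v hv => ?_) (hint.2 k α hα.1 x hx)
    (hint.2 (-k) (-α) (neg_ne_zero.2 hα.1) y hy)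
  · rw [mem_hEig.1 (wtSp_le_hEig _ hv) (T.coroot α)]
    simp [T.coroot_two α hα, mul_comm]
  · refine hlz.E_mem_wtSp hx hv (by simp [add_smul, add_assoc]) fun i => ?_
    push_cast
    ring
  · refine hlz.E_mem_wtSp hy hv (by simp [add_smul, add_assoc]) fun i => ?_
    rw [Pi.neg_apply]
    push_cast
    ring

/-- Root strings through a weight are bounded uniformly in the degree. -/
lemma Irr.exists_forall_wtSp_eq_bot (hirr : M.Irr) (hlz : M.LevelZero) (hint : M.Integrable)
    (hfin : M.FinWt) (hfaith : ∀ x ∈ P.gr 0, M.ρ (X.E 0 x) = 0 → x = 0)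
    {α : Module.Dual ℂ ↥C.h0} (hα : α ∈ C.Δen) (lam : Module.Dual ℂ ↥C.h0) :
    ∃ J : ℕ, ∀ j ≥ J, ∀ b, M.wtSp (lam + j • α, 0, b) = ⊥ := by
  obtain ⟨w, hw⟩ := hirr.exists_wtSp_ne_bot hint.1
  obtain ⟨-, k, hk⟩ := id hα
  obtain ⟨x, hx, hx0⟩ := Submodule.exists_mem_ne_zero_of_ne_bot hk
  obtain ⟨y, hy, hxy⟩ := T.exists_lie_eq_coroot (hint.1.gr_le_iSup_wtg hfaith) hα hx hx0
  choose J hJ using fun z : Fin P.n → ℤ => hlz.exists_forall_wtSp_eq_bot_of_mem hint hfin hfaith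
    hα hx hy hxy lam (fun i => w.2.2 i + z i)
  obtain ⟨B, hB⟩ := ((Set.finite_Icc (0 : Fin P.n → ℤ) fun i => P.m i).image J).bddAbove
  obtain ⟨N, hN⟩ := exists_nat_gt ‖lam (T.coroot α)‖
  refine ⟨N + B + 1, fun j hj b => ?_⟩
  by_contra hbot
  obtain ⟨v, hv, hv0⟩ := Submodule.exists_mem_ne_zero_of_ne_bot hbot
  obtain ⟨s, rfl⟩ := hirr.exists_eq_add_of_dEig_ne_bot
    (ne_bot_of_le_ne_bot hw (wtSp_le_dEig w)) (ne_bot_of_le_ne_bot hbot (wtSp_le_dEig _))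
  obtain ⟨z, r, hr, hz, hzr⟩ : ∃ z r : Fin P.n → ℤ, P.inΓ r ∧
      z ∈ Set.Icc (0 : Fin P.n → ℤ) (fun i => (P.m i : ℤ)) ∧ ∀ i, z i + r i = s i - j * k i := by
    have hm (i : Fin P.n) : (0 : ℤ) < P.m i := by exact_mod_cast P.mpos i
    exact ⟨fun i => (s i - j * k i) % P.m i, fun i => P.m i * ((s i - j * k i) / P.m i),
      fun i => Dvd.intro _ rfl, ⟨fun i => Int.emod_nonneg _ (hm i).ne',
      fun i => (Int.emod_lt_of_pos _ (hm i)).le⟩, fun i => Int.emod_add_mul_ediv _ _⟩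
  have hx' : x ∈ C.wtg (r + k) α := by rwa [Cartan.wtg_add_eq hr]
  have hy' : y ∈ C.wtg (-(r + k)) (-α) := by
    rwa [neg_add, Cartan.wtg_add_eq (PreT.inΓ_neg hr)]
  refine hv0 ((hlz.isSl2Triple hfaith hα hx' hy' hxy).eq_zero_of_apply_f_eq_zero
    (hint.2 _ α hα.1 x hx') (fun n hn => ?_) (mem_hEig.1 (wtSp_le_hEig _ hv) (T.coroot α)) ?_)
  · have : lam (T.coroot α) = -((n + 2 * j : ℕ) : ℂ) := by
      simp only [LinearMap.add_apply, LinearMap.smul_apply, T.coroot_two α hα, nsmul_eq_mul]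
        at hn
      push_cast
      linear_combination hn
    rw [this, norm_neg, Complex.norm_natCast] at hN
    have := Nat.cast_lt.1 hN
    omega
  · rw [← Submodule.mem_bot ℂ,
      ← hJ z (j - 1) (by have := hB (Set.mem_image_of_mem J hz); omega)]
    obtain ⟨j, rfl⟩ := Nat.exists_eq_add_of_le' (by omega : 1 ≤ j)
    refine hlz.E_mem_wtSp hy' hv (by simp [add_smul, add_assoc]) fun i => ?_
    have h := congrArg (Int.cast : ℤ → ℂ) (hzr i)
    rw [Pi.neg_apply, Pi.add_apply]
    push_cast [Nat.add_sub_cancel] at h ⊢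
    linear_combination -h

lemma mem_Vplus {v : M.V} :
    v ∈ M.Vplus ↔ ∀ α ∈ T.pos, ∀ k, ∀ x ∈ C.wtg k α, M.ρ (X.E k x) v = 0 := by
  simp only [Vplus, Submodule.mem_iInf, LinearMap.mem_ker]
  constructor
  · exact fun h α hα k x hx => h _ ⟨α, hα, k, x, hx, rfl⟩
  · rintro h _ ⟨α, hα, k, x, hx, rfl⟩
    exact h α hα k x hx

lemma ρ_lie_E_eq_zero {α β : Module.Dual ℂ ↥C.h0} (hαβ : α + β ≠ 0) {k l : Fin P.n → ℤ}
    {x y : P.g} (hx : x ∈ C.wtg k α) (hy : y ∈ C.wtg l β) {v : M.V}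
    (hv : α + β ∈ C.Δen → ∀ z ∈ C.wtg (k + l) (α + β), M.ρ (X.E (k + l) z) v = 0) :
    M.ρ ⁅X.E k x, X.E l y⁆ v = 0 := by
  rw [X.br_EE k l x y hx.1 hy.1, Cartan.bil_eq_zero hx.2 hy.2 hαβ, zero_smul, add_zero]
  have hxy := Cartan.lie_mem_wtg hx hy
  by_cases hΔ : α + β ∈ C.Δen
  · exact hv hΔ _ hxy
  · have hbot : C.wtg (k + l) (α + β) = ⊥ := by
      by_contra h
      exact hΔ ⟨hαβ, _, h⟩
    rw [hbot, Submodule.mem_bot] at hxy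
    rw [hxy, map_zero, map_zero, LinearMap.zero_apply]

lemma exists_mem_wtSp_insert (hlz : M.LevelZero) {A : Set (Module.Dual ℂ ↥C.h0)}
    {β : Module.Dual ℂ ↥C.h0} (hA : ∀ α ∈ A, α + β ≠ 0 ∧ (α + β ∈ C.Δen → α + β ∈ A))
    {lam : Module.Dual ℂ ↥C.h0} (hfin : ∃ J : ℕ, ∀ j ≥ J, ∀ b, M.wtSp (lam + j • β, 0, b) = ⊥)
    {b : Fin P.n → ℂ} {v : M.V} (hv : v ∈ M.wtSp (lam, 0, b)) (hv0 : v ≠ 0)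
    (hvA : ∀ α ∈ A, ∀ k, ∀ x ∈ C.wtg k α, M.ρ (X.E k x) v = 0) :
    ∃ lam b, ∃ v ∈ M.wtSp (lam, 0, b), v ≠ 0 ∧
      ∀ α ∈ insert β A, ∀ k, ∀ x ∈ C.wtg k α, M.ρ (X.E k x) v = 0 := by
  by_contra! hcon
  have key (j : ℕ) : ∃ b, ∃ v ∈ M.wtSp (lam + j • β, 0, b), v ≠ 0 ∧
      ∀ α ∈ A, ∀ k, ∀ x ∈ C.wtg k α, M.ρ (X.E k x) v = 0 := by
    induction j with
    | zero => exact ⟨b, v, by simpa using hv, hv0, hvA⟩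
    | succ j ih =>
      obtain ⟨b, v, hv, hv0, hvA⟩ := ih
      obtain ⟨α, hα, k, x, hx, hne⟩ := hcon _ _ v hv hv0
      obtain rfl : α = β := hα.resolve_right fun hα => hne (hvA α hα k x hx)
      refine ⟨fun i => b i + k i, _, hlz.E_mem_wtSp hx hv (by simp [add_smul, add_assoc])
        fun _ => rfl, hne, fun γ hγ l y hy => ?_⟩
      rw [ρ_apply_ρ_apply, hvA γ hγ l y hy, map_zero, zero_add]
      exact ρ_lie_E_eq_zero (hA γ hγ).1 hy hx fun hΔ => hvA _ ((hA γ hγ).2 hΔ) _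
  obtain ⟨J, hJ⟩ := hfin
  obtain ⟨b, v, hv, hv0, -⟩ := key J
  rw [hJ J le_rfl b] at hv
  exact hv0 hv

end TRep

namespace Torus

variable {P : PreT} {C : Cartan P} (T : Torus P C)

lemma exists_forall_add_mem (hD : ∀ k, P.gr k ≤ ⨆ α, C.wtg k α)
    {A : Set (Module.Dual ℂ ↥C.h0)} (hA : A ⊂ T.pos) :
    ∃ β ∈ T.pos \ A, ∀ γ ∈ T.pos, β + γ ∈ T.pos → β + γ ∈ A := by
  let r (x y : Module.Dual ℂ ↥C.h0) : Prop := ∃ γ ∈ T.posCone, γ ≠ 0 ∧ x = y + γ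
  have : IsStrictOrder _ r :=
    { irrefl := by
        rintro x ⟨γ, -, hγ, h⟩
        exact hγ (left_eq_add.1 h)
      trans := by
        rintro x y z ⟨γ, hγ, hγ0, rfl⟩ ⟨δ, hδ, hδ0, rfl⟩
        exact ⟨δ + γ, add_mem hδ hγ, fun h => hδ0 (T.eq_zero_of_add_eq_zero hD hδ hγ h),
          add_assoc _ _ _⟩ }
  have hwf := (Cartan.finite_Δen.subset (Set.sdiff_subset.trans T.pos_sub) :
    (T.pos \ A).Finite).wellFoundedOn (r := r)
  obtain ⟨β₀, hβ₀, hβ₀A⟩ := Set.exists_of_ssubset hA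
  obtain ⟨⟨β, hβ⟩, -, hmin⟩ := WellFounded.has_min hwf Set.univ ⟨⟨β₀, hβ₀, hβ₀A⟩, trivial⟩
  refine ⟨β, hβ, fun γ hγ hβγ => ?_⟩
  by_contra hn
  exact hmin ⟨β + γ, hβγ, hn⟩ trivial ⟨γ, T.mem_posCone_of_mem_pos hγ, (T.pos_sub hγ).1, rfl⟩

end Torus

namespace TRep

variable {P : PreT} {C : Cartan P} {T : Torus P C} {X : Toroidal P C T} {M : TRep X}

/-- The space of vectors killed by `τ̃₊` contains a weight vector. -/
lemma Irr.exists_mem_wtSp_mem_Vplus (hirr : M.Irr) (hlz : M.LevelZero) (hint : M.Integrable)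
    (hfin : M.FinWt) (hfaith : ∀ x ∈ P.gr 0, M.ρ (X.E 0 x) = 0 → x = 0) :
    ∃ lam b, ∃ v ∈ M.wtSp (lam, 0, b), v ≠ 0 ∧ v ∈ M.Vplus := by
  have hD := hint.1.gr_le_iSup_wtg hfaith
  let S : Set (Set (Module.Dual ℂ ↥C.h0)) := {A | A ⊆ T.pos ∧
    (∀ α ∈ A, ∀ γ ∈ T.pos, α + γ ∈ C.Δen → α + γ ∈ A) ∧ ∃ lam b, ∃ v ∈ M.wtSp (lam, 0, b), v ≠ 0 ∧
      ∀ α ∈ A, ∀ k, ∀ x ∈ C.wtg k α, M.ρ (X.E k x) v = 0}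
  have hSfin : S.Finite :=
    (Cartan.finite_Δen.subset T.pos_sub).finite_subsets.subset fun A hA => hA.1
  have hS0 : ∅ ∈ S := by
    obtain ⟨w, hw⟩ := hirr.exists_wtSp_ne_bot hint.1
    obtain ⟨v, hv, hv0⟩ := Submodule.exists_mem_ne_zero_of_ne_bot hw
    refine ⟨Set.empty_subset _, by simp, w.1, w.2.2, v, ?_, hv0, by simp⟩
    rwa [← hlz.snd_eq_zero hv hv0]
  obtain ⟨A, hA, hmax⟩ := hSfin.exists_maximal ⟨∅, hS0⟩
  obtain ⟨hApos, hAup, lam, b, v, hv, hv0, hvA⟩ := id hA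
  rcases eq_or_ssubset_of_subset hApos with rfl | hss
  · exact ⟨lam, b, v, hv, hv0, mem_Vplus.2 hvA⟩
  obtain ⟨β, ⟨hβ, hβA⟩, hβup⟩ := T.exists_forall_add_mem hD hss
  have hne {α γ} (hα : α ∈ T.pos) (hγ : γ ∈ T.pos) : α + γ ≠ 0 := fun h =>
    (T.pos_sub hα).1 (T.eq_zero_of_add_eq_zero hD (T.mem_posCone_of_mem_pos hα)
      (T.mem_posCone_of_mem_pos hγ) h)
  refine absurd (hmax (y := insert β A) ⟨Set.insert_subset hβ hApos, ?_, ?_⟩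
    (Set.subset_insert β A) (Set.mem_insert β A)) hβA
  · rintro α (rfl | hα) γ hγ hαγ
    · exact Or.inr (hβup γ hγ (T.pos_add _ hβ γ hγ hαγ))
    · exact Or.inr (hAup α hα γ hγ hαγ)
  · exact exists_mem_wtSp_insert hlz (fun α hα => ⟨hne (hApos hα) hβ, hAup α hα β hβ⟩)
      (hirr.exists_forall_wtSp_eq_bot hlz hint hfin hfaith (T.pos_sub hβ) lam) hv hv0 hvA

end TRep

namespace Toroidal

variable {P : PreT} {C : Cartan P} {T : Torus P C} (X : Toroidal P C T)

lemma span_tauP_union_tauM_union_tauZ (hD : ∀ k, P.gr k ≤ ⨆ α, C.wtg k α) :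
    Submodule.span ℂ (X.tauP ∪ X.tauM ∪ X.tauZ) = ⊤ := by
  rw [← top_le_iff, ← X.span_top, Submodule.span_le]
  rintro t ((⟨k, x, hx, rfl⟩ | ⟨r, j, hr, rfl⟩) | ⟨r, j, hr, rfl⟩)
  · suffices h : ⨆ α, C.wtg k α ≤
        (Submodule.span ℂ (X.tauP ∪ X.tauM ∪ X.tauZ)).comap (X.E k) from h (hD k hx)
    refine iSup_le fun α x hx => ?_
    by_cases hx0 : x = 0
    · simp [hx0]
    refine Submodule.subset_span ?_
    by_cases hα : α = 0
    · subst hα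
      exact Or.inr (Or.inl ⟨k, x, hx, rfl⟩)
    rcases T.pos_total α ⟨hα, k, (Submodule.ne_bot_iff _).2 ⟨x, hx, hx0⟩⟩ with h | h
    · exact Or.inl (Or.inl ⟨α, h, k, x, hx, rfl⟩)
    · exact Or.inl (Or.inr ⟨α, h, k, x, hx, rfl⟩)
  · exact Submodule.subset_span (Or.inr (Or.inr ⟨r, j, hr, Or.inl rfl⟩))
  · exact Submodule.subset_span (Or.inr (Or.inr ⟨r, j, hr, Or.inr rfl⟩))

lemma lie_E_h0_eq_zero_of_mem_tauZ (h : ↥C.h0) {t : X.τ} (ht : t ∈ X.tauZ) :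
    ⁅X.E 0 (h : P.g), t⁆ = 0 := by
  rcases ht with ⟨k, x, hx, rfl⟩ | ⟨r, i, hr, rfl | rfl⟩
  · rw [X.lie_E_h0_E h hx, LinearMap.zero_apply, zero_smul]
  · exact X.br_EK 0 h (C.h0_le h.2) r i
  · rw [← lie_skew, X.br_DE r hr i 0 h (C.h0_le h.2)]
    simp

end Toroidal

namespace TRep

variable {P : PreT} {C : Cartan P} {T : Torus P C} {X : Toroidal P C T} {M : TRep X}

lemma apply_mem_hEig_of_mem_tauZ {t : X.τ} (ht : t ∈ X.tauZ) {lam : Module.Dual ℂ ↥C.h0}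
    {v : M.V} (hv : v ∈ M.hEig lam) : M.ρ t v ∈ M.hEig lam :=
  mem_hEig.2 fun h => by
    rw [ρ_apply_ρ_apply, mem_hEig.1 hv h, X.lie_E_h0_eq_zero_of_mem_tauZ h ht]
    simp

lemma apply_mem_Vplus_of_mem_tauZ {t : X.τ} (ht : t ∈ X.tauZ) {v : M.V} (hv : v ∈ M.Vplus) :
    M.ρ t v ∈ M.Vplus := by
  rw [mem_Vplus] at *
  intro α hα k x hx
  rw [ρ_apply_ρ_apply, hv α hα k x hx, map_zero, zero_add]
  rcases ht with ⟨l, y, hy, rfl⟩ | ⟨r, i, hr, rfl | rfl⟩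
  · refine ρ_lie_E_eq_zero (by simpa using (T.pos_sub hα).1) hx hy fun _ => ?_
    rw [add_zero]
    exact hv α hα _
  · rw [X.br_EK k x hx.1, map_zero, LinearMap.zero_apply]
  · rw [← lie_skew, X.br_DE r hr i k x hx.1, map_neg, map_smul, LinearMap.neg_apply,
      LinearMap.smul_apply, hv α hα (r + k) x (by rwa [Cartan.wtg_add_eq hr]), smul_zero, neg_zero]

/-- A `τ̃₀`-submodule of `V₊` generates the whole module under `τ̃₋`. -/
lemma Irr.eq_top_of_tauM (hirr : M.Irr) (hD : ∀ k, P.gr k ≤ ⨆ α, C.wtg k α)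
    {U W : Submodule ℂ M.V} (hU0 : U ≠ ⊥) (hU : U ≤ M.Vplus)
    (hUZ : ∀ t ∈ X.tauZ, ∀ v ∈ U, M.ρ t v ∈ U) (hUW : U ≤ W)
    (hW : ∀ t ∈ X.tauM, ∀ v ∈ W, M.ρ t v ∈ W) : W = ⊤ := by
  let N : Submodule ℂ M.V := sInf {W | U ≤ W ∧ ∀ t ∈ X.tauM, ∀ v ∈ W, M.ρ t v ∈ W}
  have hNle {W : Submodule ℂ M.V} (h₁ : U ≤ W) (h₂ : ∀ t ∈ X.tauM, ∀ v ∈ W, M.ρ t v ∈ W) :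
      N ≤ W := sInf_le ⟨h₁, h₂⟩
  have hUN : U ≤ N := le_sInf fun _ h => h.1
  have hN : ∀ t ∈ X.tauM, ∀ v ∈ N, M.ρ t v ∈ N := fun t ht v hv =>
    Submodule.mem_sInf.2 fun W' h => h.2 t ht v (hNle h.1 h.2 hv)
  have hstab : N ≤ N ⊓ ⨅ t, N.comap (M.ρ t) := by
    refine hNle (fun u hu => ⟨hUN hu, ?_⟩) fun f hf v hv => ⟨hN f hf v hv.1, ?_⟩
    · refine (Submodule.mem_iInf _).2 fun t => ?_
      rw [Submodule.mem_comap]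
      refine mapsTo_of_mem_span (S := X.tauP ∪ X.tauM ∪ X.tauZ) (U := U) (W := N) ?_ t
        (X.span_tauP_union_tauM_union_tauZ hD ▸ Submodule.mem_top) u hu
      rintro t ((ht | ht) | ht) v hv
      · obtain ⟨α, hα, k, x, hx, rfl⟩ := ht
        rw [mem_Vplus.1 (hU hv) α hα k x hx]
        exact N.zero_mem
      · exact hN t ht v (hUN hv)
      · exact hUN (hUZ t ht v hv)
    · have hv' := (Submodule.mem_iInf _).1 hv.2
      refine (Submodule.mem_iInf _).2 fun t => ?_
      rw [Submodule.mem_comap, ρ_apply_ρ_apply]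
      exact N.add_mem (hN f hf _ (hv' t)) (hv' ⁅t, f⁆)
  have hNtop : N = ⊤ := (hirr.2 N fun t v hv =>
    (Submodule.mem_iInf _).1 (hstab hv).2 t).resolve_left fun h => hU0 (le_bot_iff.1 (h ▸ hUN))
  exact top_le_iff.1 (hNtop ▸ hNle hUW hW)

lemma Irr.sup_iSup_hEig_eq_top (hirr : M.Irr) (hD : ∀ k, P.gr k ≤ ⨆ α, C.wtg k α)
    {lam : Module.Dual ℂ ↥C.h0} {U : Submodule ℂ M.V} (hU0 : U ≠ ⊥)
    (hU : U ≤ M.Vplus) (hUlam : U ≤ M.hEig lam) (hUZ : ∀ t ∈ X.tauZ, ∀ v ∈ U, M.ρ t v ∈ U) :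
    U ⊔ ⨆ q : {q // q ∈ T.posCone ∧ q ≠ 0}, M.hEig (lam - q) = ⊤ := by
  refine hirr.eq_top_of_tauM hD hU0 hU hUZ le_sup_left ?_
  rintro _ ⟨α, hα, k, x, hx, rfl⟩ v hv
  have hα' := T.mem_posCone_of_mem_pos hα
  suffices h : U ⊔ ⨆ q : {q // q ∈ T.posCone ∧ q ≠ 0}, M.hEig (lam - q) ≤
      (⨆ q : {q // q ∈ T.posCone ∧ q ≠ 0}, M.hEig (lam - q)).comap (M.ρ (X.E k x)) from
    Submodule.mem_sup_right (h hv)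
  refine sup_le (fun u hu => ?_) (iSup_le fun ⟨q, hq, hq0⟩ u hu => ?_)
  · refine Submodule.mem_iSup_of_mem ⟨-α, hα', (T.pos_sub hα).1⟩ ?_
    simpa using E_mem_hEig hx (hUlam hu)
  · refine Submodule.mem_iSup_of_mem ⟨q + -α, add_mem hq hα',
      fun h => hq0 (T.eq_zero_of_add_eq_zero hD hq hα' h)⟩ ?_
    have := E_mem_hEig hx hu
    rwa [show lam - (q + -α) = lam - q + α by abel]

lemma Irr.hEig_le (hirr : M.Irr) (hD : ∀ k, P.gr k ≤ ⨆ α, C.wtg k α)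
    {lam : Module.Dual ℂ ↥C.h0} {U : Submodule ℂ M.V} (hU0 : U ≠ ⊥)
    (hU : U ≤ M.Vplus) (hUlam : U ≤ M.hEig lam) (hUZ : ∀ t ∈ X.tauZ, ∀ v ∈ U, M.ρ t v ∈ U) :
    M.hEig lam ≤ U := by
  intro v hv
  obtain ⟨u, hu, w, hw, rfl⟩ := Submodule.mem_sup.1
    ((hirr.sup_iSup_hEig_eq_top hD hU0 hU hUlam hUZ).symm ▸ Submodule.mem_top (x := v))
  have hw' : w ∈ M.hEig lam := by
    simpa using sub_mem hv (hUlam hu)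
  have : w = 0 := by
    refine Submodule.disjoint_def.1 (iSupIndep_hEig (M := M) lam) w hw'
      (SetLike.le_def.1 (iSup_le fun q => ?_) hw)
    exact le_iSup₂_of_le (lam - q) (by simpa using q.2.2) le_rfl
  simpa [this] using hu

lemma Irr.sub_mem_posCone (hirr : M.Irr) (hD : ∀ k, P.gr k ≤ ⨆ α, C.wtg k α)
    {lam mu : Module.Dual ℂ ↥C.h0} (hlam : M.Vplus ⊓ M.hEig lam ≠ ⊥) (hmu : M.hEig mu ≠ ⊥) :
    lam - mu ∈ T.posCone := by
  have htop := hirr.sup_iSup_hEig_eq_top hD hlam inf_le_left inf_le_right fun t ht v hv =>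
    ⟨apply_mem_Vplus_of_mem_tauZ ht hv.1, apply_mem_hEig_of_mem_tauZ ht hv.2⟩
  obtain ⟨q, rfl⟩ := iSupIndep_hEig.exists_eq_of_ne_bot
    (f := fun q : T.posCone => lam - (q : Module.Dual ℂ ↥C.h0)) (by
    rw [← top_le_iff, ← htop]
    refine sup_le (inf_le_right.trans (le_iSup_of_le 0 (by simp))) (iSup_le fun q => ?_)
    exact le_iSup_of_le (⟨q, q.2.1⟩ : T.posCone) le_rfl) hmu
  simp

lemma IsWeight.Vplus_le_iSup (hw : M.IsWeight) : M.Vplus ≤ ⨆ lam, M.Vplus ⊓ M.hEig lam := by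
  intro v hv
  obtain ⟨f, hf, rfl⟩ := (Submodule.mem_iSup_iff_exists_finsupp _ v).1
    (hw.iSup_hEig_eq_top.symm ▸ Submodule.mem_top (x := v))
  refine Submodule.sum_mem _ fun lam hlam => Submodule.mem_iSup_of_mem lam ⟨?_, hf lam⟩
  refine mem_Vplus.2 fun α hα k x hx => ?_
  have hind : iSupIndep fun mu => M.hEig (mu + α) := iSupIndep_hEig.comp (add_left_injective α)
  refine hind.eq_zero_of_finsupp_sum_eq_zero (s := f.support) (v := fun mu => M.ρ (X.E k x) (f mu))
    (fun mu _ => E_mem_hEig hx (hf mu)) ?_ lam hlam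
  have := mem_Vplus.1 hv α hα k x hx
  rwa [Finsupp.sum, map_sum] at this

lemma Irr.Vplus_le_hEig (hirr : M.Irr) (hw : M.IsWeight) (hD : ∀ k, P.gr k ≤ ⨆ α, C.wtg k α)
    {lam : Module.Dual ℂ ↥C.h0} (hlam : M.Vplus ⊓ M.hEig lam ≠ ⊥) : M.Vplus ≤ M.hEig lam := by
  refine hw.Vplus_le_iSup.trans (iSup_le fun mu => ?_)
  by_cases hmu : M.Vplus ⊓ M.hEig mu = ⊥
  · rw [hmu]
    exact bot_le
  have h : lam - mu = 0 := T.eq_zero_of_add_eq_zero hD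
    (hirr.sub_mem_posCone hD hlam (ne_bot_of_le_ne_bot hmu inf_le_right))
    (hirr.sub_mem_posCone hD hmu (ne_bot_of_le_ne_bot hlam inf_le_right)) (by abel)
  rw [sub_eq_zero.1 h]
  exact inf_le_right

/-- `V₊` is an irreducible `τ̃₀`-module on which `𝔥_{0̄}` acts by a single weight. -/
lemma Irr.exists_Vplus_le_hEig_of_faithful (hirr : M.Irr) (hint : M.Integrable)
    (hlz : M.LevelZero) (hfin : M.FinWt) (hfaith : ∀ x ∈ P.gr 0, M.ρ (X.E 0 x) = 0 → x = 0) :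
    (∃ w, M.wtSp w ⊓ M.Vplus ≠ ⊥) ∧ (∃ lam, M.Vplus ≤ M.hEig lam) ∧
      ∀ U : Submodule ℂ M.V, U ≤ M.Vplus →
        (∀ t ∈ X.tauZ, ∀ v ∈ U, M.ρ t v ∈ U) → U = ⊥ ∨ U = M.Vplus := by
  have hD := hint.1.gr_le_iSup_wtg hfaith
  obtain ⟨lam, b, v, hv, hv0, hvV⟩ := hirr.exists_mem_wtSp_mem_Vplus hlz hint hfin hfaith
  have hle := hirr.Vplus_le_hEig hint.1 hD
    ((Submodule.ne_bot_iff _).2 ⟨v, ⟨hvV, wtSp_le_hEig _ hv⟩, hv0⟩)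
  refine ⟨⟨_, (Submodule.ne_bot_iff _).2 ⟨v, ⟨hv, hvV⟩, hv0⟩⟩, ⟨lam, hle⟩, fun U hU hUZ => ?_⟩
  exact or_iff_not_imp_left.2 fun hU0 => hU.antisymm
    (hle.trans (hirr.hEig_le hD hU0 hU (hU.trans hle) hUZ))

lemma ρ_E_eq_zero_of_gr_zero (h0 : ∀ x ∈ P.gr 0, M.ρ (X.E 0 x) = 0) {k : Fin P.n → ℤ} {x y : P.g}
    (hx : x ∈ P.gr 0) (hy : y ∈ P.gr k) : M.ρ (X.E k ⁅x, y⁆) = 0 := by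
  rw [← X.lie_E_zero_E hx hy, M.ρ_lie, h0 x hx, zero_mul, mul_zero, sub_zero]

lemma ρ_E_eq_zero_of_mem_wtg (h0 : ∀ x ∈ P.gr 0, M.ρ (X.E 0 x) = 0) {k : Fin P.n → ℤ}
    {α : Module.Dual ℂ ↥C.h0} (hα : α ≠ 0) {x : P.g} (hx : x ∈ C.wtg k α) :
    M.ρ (X.E k x) = 0 := by
  obtain ⟨h, hh⟩ := DFunLike.ne_iff.1 hα
  have := ρ_E_eq_zero_of_gr_zero h0 (C.h0_le h.2) hx.1
  rw [Cartan.mem_wtfull.1 hx.2 h, map_smul, map_smul, smul_eq_zero] at this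
  exact this.resolve_left hh

lemma ρ_E_eq_zero_of_inΓ (h0 : ∀ x ∈ P.gr 0, M.ρ (X.E 0 x) = 0) {k : Fin P.n → ℤ}
    (hk : P.inΓ k) {x : P.g} (hx : x ∈ P.gr k) : M.ρ (X.E k x) = 0 := by
  have hgr : P.gr k = P.gr 0 := by simpa using PreT.gr_add_eq hk (k := 0)
  rw [hgr] at hx
  rcases T.g0_ideals (P.gr 0 ⊓ LinearMap.ker (M.ρ ∘ₗ X.E k)) inf_le_left fun a ha u hu =>
    ⟨by simpa using PreT.lie_mem_gr ha hu.1, ρ_E_eq_zero_of_gr_zero h0 ha (hgr ▸ hu.1)⟩ with h | h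
  · obtain ⟨a, ha, b, hb, hab⟩ := T.g0_nonabelian
    refine absurd ((Submodule.mem_bot ℂ).1 (h ▸ (?_ : ⁅a, b⁆ ∈ _))) hab
    exact ⟨by simpa using PreT.lie_mem_gr ha hb, ρ_E_eq_zero_of_gr_zero h0 ha (hgr ▸ hb)⟩
  · have hx' : x ∈ P.gr 0 ⊓ LinearMap.ker (M.ρ ∘ₗ X.E k) := by rwa [h]
    exact hx'.2

lemma Irr.exists_Vplus_le_hEig_of_gr_zero (hirr : M.Irr) (hw : M.IsWeight)
    (h0 : ∀ x ∈ P.gr 0, M.ρ (X.E 0 x) = 0) :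
    (∃ w, M.wtSp w ⊓ M.Vplus ≠ ⊥) ∧ (∃ lam, M.Vplus ≤ M.hEig lam) ∧
      ∀ U : Submodule ℂ M.V, U ≤ M.Vplus →
        (∀ t ∈ X.tauZ, ∀ v ∈ U, M.ρ t v ∈ U) → U = ⊥ ∨ U = M.Vplus := by
  have htop : M.Vplus = ⊤ := by
    refine top_le_iff.1 fun v _ => mem_Vplus.2 fun α hα k x hx => ?_
    rw [ρ_E_eq_zero_of_mem_wtg h0 (T.pos_sub hα).1 hx, LinearMap.zero_apply]
  refine ⟨?_, ⟨0, fun v _ => mem_hEig.2 fun h => by simp [h0 _ (C.h0_le h.2)]⟩, fun U _ hUZ => ?_⟩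
  · simpa [htop] using hirr.exists_wtSp_ne_bot hw
  rw [htop, or_iff_not_imp_left]
  refine fun hU0 => hirr.eq_top_of_mapsTo X.span_top hU0 ?_
  rintro t ((⟨k, x, hx, rfl⟩ | ⟨r, j, hr, rfl⟩) | ⟨r, j, hr, rfl⟩) v hv
  · by_cases hk : P.inΓ k
    · rw [ρ_E_eq_zero_of_inΓ h0 hk hx]
      exact U.zero_mem
    suffices h : ⨆ α, C.wtg k α ≤ U.comap ((M.ρ ∘ₗ X.E k).flip v) from
      h (T.gr_le_iSup_wtg_of_not_inΓ hk hx)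
    refine iSup_le fun α x hx => ?_
    rw [Submodule.mem_comap, LinearMap.flip_apply, LinearMap.comp_apply]
    by_cases hα : α = 0
    · subst hα
      exact hUZ _ (Or.inl ⟨k, x, hx, rfl⟩) v hv
    · rw [ρ_E_eq_zero_of_mem_wtg h0 hα hx]
      exact U.zero_mem
  · exact hUZ _ (Or.inr ⟨r, j, hr, Or.inl rfl⟩) v hv
  · exact hUZ _ (Or.inr ⟨r, j, hr, Or.inr rfl⟩) v hv

lemma Irr.exists_Vplus_le_hEig (hirr : M.Irr) (hint : M.Integrable)
    (hlz : M.LevelZero) (hfin : M.FinWt) :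
    (∃ w, M.wtSp w ⊓ M.Vplus ≠ ⊥) ∧ (∃ lam, M.Vplus ≤ M.hEig lam) ∧
      ∀ U : Submodule ℂ M.V, U ≤ M.Vplus →
        (∀ t ∈ X.tauZ, ∀ v ∈ U, M.ρ t v ∈ U) → U = ⊥ ∨ U = M.Vplus := by
  rcases T.g0_ideals (P.gr 0 ⊓ LinearMap.ker (M.ρ ∘ₗ X.E 0)) inf_le_left fun a ha u hu =>
    ⟨by simpa using PreT.lie_mem_gr ha hu.1, by
      have hu' : M.ρ (X.E 0 u) = 0 := hu.2
      change M.ρ (X.E 0 ⁅a, u⁆) = 0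
      rw [← X.lie_E_zero_E ha hu.1, M.ρ_lie, hu', zero_mul, mul_zero, sub_zero]⟩ with h | h
  · exact hirr.exists_Vplus_le_hEig_of_faithful hint hlz hfin fun x hx hx0 =>
      (Submodule.mem_bot ℂ).1 (h ▸ ⟨hx, hx0⟩)
  · refine hirr.exists_Vplus_le_hEig_of_gr_zero hint.1 fun x hx => ?_
    have hx' : x ∈ P.gr 0 ⊓ LinearMap.ker (M.ρ ∘ₗ X.E 0) := by rwa [h]
    exact hx'.2

lemma eq_of_mem_hEig {lam mu : Module.Dual ℂ ↥C.h0} {v : M.V} (hv0 : v ≠ 0)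
    (hlam : v ∈ M.hEig lam) (hmu : v ∈ M.hEig mu) : lam = mu :=
  LinearMap.ext fun h =>
    smul_left_injective ℂ hv0 ((mem_hEig.1 hlam h).symm.trans (mem_hEig.1 hmu h))

end TRep

section Statements

variable {P : PreT} {C : Cartan P} {T : Torus P C} {X : Toroidal P C T}

/-- Lemma 3.5: (1) `V₊` is an irreducible `τ̃₀`-module; (2) there exist a unique
`λ̄ ∈ 𝔥_{0̄}*` and some `β ∈ ℂⁿ` with `P(V₊) ⊆ {λ̄ + δ_{r+β} | r ∈ ℤⁿ}`. -/
theorem statement2 (M : TRep X) (hirr : M.Irr) (hint : M.Integrable)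
    (hlz : M.LevelZero) (hfin : M.FinWt) :
    (M.Vplus ≠ ⊥ ∧
      ∀ U : Submodule ℂ M.V, U ≤ M.Vplus →
        (∀ t ∈ X.tauZ, ∀ v ∈ U, M.ρ t v ∈ U) → U = ⊥ ∨ U = M.Vplus) ∧
    (∃! lam0 : Module.Dual ℂ ↥C.h0, ∃ β : Fin P.n → ℂ,
      ∀ w : C.Wt, M.wtSp w ⊓ M.Vplus ≠ ⊥ →
        w.1 = lam0 ∧ w.2.1 = 0 ∧ ∃ r : Fin P.n → ℤ,
          w.2.2 = fun i => (r i : ℂ) + β i) := by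
  obtain ⟨⟨w₀, hw₀⟩, ⟨lam, hle⟩, hU⟩ := hirr.exists_Vplus_le_hEig hint hlz hfin
  have hfst : ∀ w : C.Wt, M.wtSp w ⊓ M.Vplus ≠ ⊥ → w.1 = lam := fun w hw => by
    obtain ⟨v, hv, hv0⟩ := Submodule.exists_mem_ne_zero_of_ne_bot hw
    exact TRep.eq_of_mem_hEig hv0 (TRep.wtSp_le_hEig w hv.1) (hle hv.2)
  refine ⟨⟨ne_bot_of_le_ne_bot hw₀ inf_le_right, hU⟩, lam,
    ⟨w₀.2.2, fun w hw => ⟨hfst w hw, ?_, ?_⟩⟩, ?_⟩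
  · obtain ⟨v, hv, hv0⟩ := Submodule.exists_mem_ne_zero_of_ne_bot hw
    exact hlz.snd_eq_zero hv.1 hv0
  · obtain ⟨r, hr⟩ := hirr.exists_eq_add_of_dEig_ne_bot (b := w₀.2.2) (c := w.2.2)
      (ne_bot_of_le_ne_bot hw₀ (inf_le_left.trans (TRep.wtSp_le_dEig _)))
      (ne_bot_of_le_ne_bot hw (inf_le_left.trans (TRep.wtSp_le_dEig _)))
    exact ⟨r, funext fun i => by rw [hr, add_comm]⟩
  · rintro mu ⟨β, hβ⟩
    rw [← (hβ w₀ hw₀).1, hfst w₀ hw₀]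

end Statements
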